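/- For any complete L_⊗-theories x and y extending T_MSO(Fin), the complete theory x ⊗ y is the unique complete extension of T_MSO(Fin) containing {φ + ψ : φ ∈ x, ψ ∈ y}; equivalently, viewing complete extensions of T_MSO(Fin) as ultrafilters on the Lindenbaum–Tarski algebra LT, the filter of LT generated by x +̂ y = {φ + ψ : φ ∈ x, ψ ∈ y} equals the ultrafilter x ⊗ y. -/

import Mathlib

open FirstOrder FirstOrder.Language

namespace MSO

/-! ### The language `L_⊗` and its semantics -/

/-- The language `L_⊗`: a constant `⊥`, a unary relation `At`,
and two binary relations: `⊆` (encoded `true`) and `≤ᴱ` (encoded `false`). -/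
def Lmso : Language where
  Functions := fun n => match n with | 0 => Unit | _ => Empty
  Relations := fun n => match n with | 1 => Unit | 2 => Bool | _ => Empty

/-- The constant symbol `⊥`. -/
def botC : Lmso.Constants := Unit.unit
/-- The unary relation symbol `At`. -/
def atR : Lmso.Relations 1 := Unit.unit
/-- The binary relation symbol `⊆`. -/
def subR : Lmso.Relations 2 := true
/-- The binary relation symbol `≤ᴱ`. -/
def exleR : Lmso.Relations 2 := false

/-- The interpretation of `⊥` in an `L_⊗`-structure. -/
def botE (M : Type*) [Lmso.Structure M] : M := Structure.funMap botC ![]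
/-- The interpretation of `At` in an `L_⊗`-structure. -/
def atE {M : Type*} [Lmso.Structure M] (a : M) : Prop := Structure.RelMap atR ![a]
/-- The interpretation of `⊆` in an `L_⊗`-structure. -/
def subE {M : Type*} [Lmso.Structure M] (a b : M) : Prop := Structure.RelMap subR ![a, b]
/-- The interpretation of `≤ᴱ` in an `L_⊗`-structure. -/
def exleE {M : Type*} [Lmso.Structure M] (a b : M) : Prop := Structure.RelMap exleR ![a, b]

/-- The monadic second order version `M̃SO(α)` of a linear order `α`, as an `L_⊗`-structure:
the universe is the powerset of `α`, `⊆` is inclusion, `⊥` is `∅`, `At` holds of singletons,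
and `A ≤ᴱ B` iff there are `a ∈ A` and `b ∈ B` with `a < b`. -/
instance msoStructure (α : Type*) [LinearOrder α] : Lmso.Structure (Set α) where
  funMap := fun {n} f _ => match n, f with
    | 0, _ => (∅ : Set α)
  RelMap := fun {n} r v => match n, r with
    | 1, _ => ∃ a : α, v 0 = {a}
    | 2, true => v 0 ⊆ v 1
    | 2, false => ∃ a ∈ v 0, ∃ b ∈ v 1, a < b

/-- `MSO(n)`, the monadic second order version of the `n`-element linear order. -/
abbrev MSOn (n : ℕ) : Type := Set (Fin n)

/-- The operation `⊗` on `L_⊗`-structures: the universe is the product, `⊆` is componentwise,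
`⊥` is the pair of bottoms, `At` holds of the atoms (minimal non-bottom elements) of the
resulting order, and `(A,B) ≤ᴱ (C,D)` iff (`A ≠ ⊥` and `D ≠ ⊥`), or `A ≤ᴱ C`, or `B ≤ᴱ D`. -/
instance tensorStructure (M N : Type*) [Lmso.Structure M] [Lmso.Structure N] :
    Lmso.Structure (M × N) where
  funMap := fun {n} f _ => match n, f with
    | 0, _ => (botE M, botE N)
  RelMap := fun {n} r v => match n, r with
    | 1, _ => v 0 ≠ (botE M, botE N) ∧
        ∀ q : M × N, subE q.1 (v 0).1 → subE q.2 (v 0).2 →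
          q = (botE M, botE N) ∨ q = v 0
    | 2, true => subE (v 0).1 (v 1).1 ∧ subE (v 0).2 (v 1).2
    | 2, false => ((v 0).1 ≠ botE M ∧ (v 1).2 ≠ botE N) ∨
        exleE (v 0).1 (v 1).1 ∨ exleE (v 0).2 (v 1).2

/-! ### Formulas -/

/-- Bounded `L_⊗`-formulas with no free (outer) variables. -/
abbrev BF (n : ℕ) := Lmso.BoundedFormula Empty n

/-- The `i`-th de Bruijn variable as a term. -/
def tv {n : ℕ} (i : Fin n) : Lmso.Term (Empty ⊕ Fin n) := Term.var (Sum.inr i)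
/-- The constant `⊥` as a term. -/
def tb {n : ℕ} : Lmso.Term (Empty ⊕ Fin n) := Constants.term botC

def sub' {n : ℕ} (i j : Fin n) : BF n := subR.boundedFormula₂ (tv i) (tv j)
def exle' {n : ℕ} (i j : Fin n) : BF n := exleR.boundedFormula₂ (tv i) (tv j)
def at' {n : ℕ} (i : Fin n) : BF n := atR.boundedFormula₁ (tv i)
def eq' {n : ℕ} (i j : Fin n) : BF n := Term.bdEqual (tv i) (tv j)
def isBot' {n : ℕ} (i : Fin n) : BF n := Term.bdEqual (tv i) tb
def botSub' {n : ℕ} (i : Fin n) : BF n := subR.boundedFormula₂ tb (tv i)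

/-- Finite conjunction. -/
def bigAnd {n : ℕ} (l : List (BF n)) : BF n := l.foldr (· ⊓ ·) ⊤
/-- Finite disjunction. -/
def bigOr {n : ℕ} (l : List (BF n)) : BF n := l.foldr (· ⊔ ·) ⊥

/-- `k` is the meet of `i` and `j` (with respect to `⊆`). -/
def isMeet {n : ℕ} (k i j : Fin n) : BF n :=
  sub' k i ⊓ sub' k j ⊓
    ∀' ((sub' (Fin.last n) i.castSucc ⊓ sub' (Fin.last n) j.castSucc) ⟹
      sub' (Fin.last n) k.castSucc)

/-- `k` is the join of `i` and `j` (with respect to `⊆`). -/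
def isJoin {n : ℕ} (k i j : Fin n) : BF n :=
  sub' i k ⊓ sub' j k ⊓
    ∀' ((sub' i.castSucc (Fin.last n) ⊓ sub' j.castSucc (Fin.last n)) ⟹
      sub' k.castSucc (Fin.last n))

/-- The meet of `i` and `j` is `⊥`. -/
def meetIsBot {n : ℕ} (i j : Fin n) : BF n :=
  ∀' ((sub' (Fin.last n) i.castSucc ⊓ sub' (Fin.last n) j.castSucc) ⟹ isBot' (Fin.last n))

/-- The join of `i` and `j` is the top element. -/
def joinIsTop {n : ℕ} (i j : Fin n) : BF n :=
  ∀' ((sub' i.castSucc (Fin.last n) ⊓ sub' j.castSucc (Fin.last n)) ⟹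
    ∀' (sub' (Fin.last (n + 1)) ((Fin.last n).castSucc)))

/-- `j` is a (Boolean) complement of `i`. -/
def isComplOf {n : ℕ} (j i : Fin n) : BF n := meetIsBot i j ⊓ joinIsTop i j

/-- `i` is an atom: non-bottom, and minimal among non-bottom elements. -/
def isAtomDef {n : ℕ} (i : Fin n) : BF n :=
  ∼(isBot' i) ⊓
    ∀' (sub' (Fin.last n) i.castSucc ⟹ (isBot' (Fin.last n) ⊔ eq' (Fin.last n) i.castSucc))

/-! ### The base theory `T_base` -/

def axRefl : Lmso.Sentence := ∀' sub' 0 0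
def axAntisymm : Lmso.Sentence := ∀' ∀' ((sub' 0 1 ⊓ sub' 1 0) ⟹ eq' 0 1)
def axTrans : Lmso.Sentence := ∀' ∀' ∀' ((sub' 0 1 ⊓ sub' 1 2) ⟹ sub' 0 2)
def axBotLe : Lmso.Sentence := ∀' botSub' 0
def axTop : Lmso.Sentence := ∃' ∀' (sub' 1 0)
def axMeet : Lmso.Sentence := ∀' ∀' ∃' (isMeet 2 0 1)
def axJoin : Lmso.Sentence := ∀' ∀' ∃' (isJoin 2 0 1)
def axCompl : Lmso.Sentence := ∀' ∃' (isComplOf 1 0)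
def axDistrib : Lmso.Sentence :=
  ∀' ∀' ∀' ∀' ∀' ∀' ∀' ∀'
    ((isMeet 3 0 1 ⊓ isMeet 4 0 2 ⊓ isJoin 5 1 2 ⊓ isMeet 6 0 5 ⊓ isJoin 7 3 4) ⟹ sub' 6 7)
def axAt : Lmso.Sentence := ∀' (at' 0 ⇔ isAtomDef 0)
def axAtomic : Lmso.Sentence := ∀' (∼(isBot' 0) ⟹ ∃' (at' 1 ⊓ sub' 1 0))
def axIrrefl : Lmso.Sentence := ∀' (at' 0 ⟹ ∼(exle' 0 0))
def axTransAt : Lmso.Sentence :=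
  ∀' ∀' ∀' ((at' 0 ⊓ at' 1 ⊓ at' 2 ⊓ exle' 0 1 ⊓ exle' 1 2) ⟹ exle' 0 2)
def axTrich : Lmso.Sentence :=
  ∀' ∀' ((at' 0 ⊓ at' 1) ⟹ (exle' 0 1 ⊔ eq' 0 1 ⊔ exle' 1 0))
def axExleDef : Lmso.Sentence :=
  ∀' ∀' (exle' 0 1 ⇔ ∃' ∃' (at' 2 ⊓ at' 3 ⊓ sub' 2 0 ⊓ sub' 3 1 ⊓ exle' 2 3))

/-- The comprehension axiom for a formula `η(x; Y₁,…,Yₙ)` (with `x` the last variable):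
`∀ Ȳ ∃ X ∀ x (At x → (x ⊆ X ↔ η(x; Ȳ)))`. -/
def compAx {n : ℕ} (η : BF (n + 1)) : Lmso.Sentence :=
  BoundedFormula.alls (∃' ∀' (at' (Fin.last (n + 1)) ⟹
    (sub' (Fin.last (n + 1)) ((Fin.last n).castSucc) ⇔ η.liftAt 1 n)))

/-- The base theory `T_base`: an atomic Boolean algebra under `⊆` with bottom `⊥`, `At`
holding exactly of the atoms, `≤ᴱ` linearly ordering the atoms and determined by its
restriction to the atoms, together with the comprehension scheme. -/
def Tbase : Lmso.Theory :=
  {axRefl, axAntisymm, axTrans, axBotLe, axTop, axMeet, axJoin, axCompl, axDistrib,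
    axAt, axAtomic, axIrrefl, axTransAt, axTrich, axExleDef} ∪
  ⋃ n : ℕ, Set.range (compAx (n := n))

/-! ### The theory `T_MSO(Fin)` -/

/-- `i` is the `≤ᴱ`-least atom. -/
def isLeastAtom {n : ℕ} (i : Fin n) : BF n :=
  at' i ⊓ ∀' (at' (Fin.last n) ⟹ ∼(exle' (Fin.last n) i.castSucc))

/-- `i` is the `≤ᴱ`-greatest atom. -/
def isGreatestAtom {n : ℕ} (i : Fin n) : BF n :=
  at' i ⊓ ∀' (at' (Fin.last n) ⟹ ∼(exle' i.castSucc (Fin.last n)))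

/-- `j` is the immediate `≤ᴱ`-successor of the atom `i`. -/
def isSuccOf {n : ℕ} (j i : Fin n) : BF n :=
  at' i ⊓ at' j ⊓ exle' i j ⊓
    ∀' ((at' (Fin.last n) ⊓ exle' i.castSucc (Fin.last n)) ⟹
      (eq' (Fin.last n) j.castSucc ⊔ exle' j.castSucc (Fin.last n)))

def axLeastAtom : Lmso.Sentence := (∃' at' 0) ⟹ ∃' isLeastAtom 0
def axGreatestAtom : Lmso.Sentence := (∃' at' 0) ⟹ ∃' isGreatestAtom 0
def axSucc : Lmso.Sentence :=
  ∀' ((at' 0 ⊓ ∃' (at' 1 ⊓ exle' 0 1)) ⟹ ∃' isSuccOf 1 0)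
def axPred : Lmso.Sentence :=
  ∀' ((at' 0 ⊓ ∃' (at' 1 ⊓ exle' 1 0)) ⟹ ∃' isSuccOf 0 1)
def axLeastIn : Lmso.Sentence :=
  ∀' (∼(isBot' 0) ⟹ ∃' (at' 1 ⊓ sub' 1 0 ⊓ ∀' ((at' 2 ⊓ sub' 2 0) ⟹ ∼(exle' 2 1))))

/-- The theory `T_MSO(Fin)`: `T_base` together with axioms saying that the ordering of the
atoms is discrete with endpoints, and every non-bottom element contains a least atom. -/
def TMSOFin : Lmso.Theory :=
  Tbase ∪ {axLeastAtom, axGreatestAtom, axSucc, axPred, axLeastIn}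

/-! ### Quantifier rank, unnested formulas, and `≈ₖ` -/

/-- Quantifier rank of a bounded formula. -/
def qr : ∀ {n : ℕ}, BF n → ℕ
  | _, BoundedFormula.falsum => 0
  | _, BoundedFormula.equal _ _ => 0
  | _, BoundedFormula.rel _ _ => 0
  | _, BoundedFormula.imp f g => max (qr f) (qr g)
  | _, BoundedFormula.all f => qr f + 1

/-- A formula is unnested if every atomic subformula is of one of the forms
`x = y`, `c = y`, or `R x̄` with the `xᵢ`, `y` variables (Hodges). -/
def IsUnnested : ∀ {n : ℕ}, BF n → Prop
  | _, BoundedFormula.falsum => True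
  | _, BoundedFormula.equal s t =>
      (∃ i j, s = Term.var i ∧ t = Term.var j) ∨
      (∃ (c : Lmso.Constants) (j : _), s = Constants.term c ∧ t = Term.var j)
  | _, BoundedFormula.rel _ ts => ∀ i, ∃ j, ts i = Term.var j
  | _, BoundedFormula.imp f g => IsUnnested f ∧ IsUnnested g
  | _, BoundedFormula.all f => IsUnnested f

/-- `M ≈ₖ N` : `M` and `N` satisfy the same unnested `L_⊗`-sentences of quantifier
rank at most `k`. -/
def EquivK (k : ℕ) (M N : Type*) [Lmso.Structure M] [Lmso.Structure N] : Prop :=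
  ∀ φ : Lmso.Sentence, IsUnnested φ → qr φ ≤ k → (M ⊨ φ ↔ N ⊨ φ)

/-! ### The sentences `ρ_{d,h}`, `ψ_{>n}`, `ψ_{=n}` -/

/-- The index (in `Fin d`) of `A_h` among `A₁, …, A_d`, identifying `h = 0` with `h = d`. -/
def aIdx (d h : ℕ) (hd : 0 < d) : Fin d := ⟨(h + d - 1) % d, Nat.mod_lt _ hd⟩

/-- The cyclic successor on the indices `{1, …, d}`. -/
def cyc {d : ℕ} (j : Fin d) : Fin d := ⟨((j : ℕ) + 1) % d, Nat.mod_lt _ j.pos⟩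

/-- The sentence `ρ_{d,h}`: there is a partition of the atoms into `d` non-bottom elements
`A₁, …, A_d` such that the least atom is in `A₁`, the immediate successor of an atom lying in
`A_j` lies in `A_{j+1}` (cyclically), and the greatest atom is in `A_h`. -/
def rho (d h : ℕ) : Lmso.Sentence :=
  if hd : 0 < d then
    BoundedFormula.exs (n := d) (
      -- each `A_i` is non-bottom
      bigAnd ((List.finRange d).map fun i => ∼(isBot' i)) ⊓
      -- every atom lies in some `A_i`
      (∀' (at' (Fin.last d) ⟹
        bigOr ((List.finRange d).map fun i => sub' (Fin.last d) i.castSucc))) ⊓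
      -- the `A_i` are pairwise disjoint on atoms
      bigAnd ((List.finRange d).flatMap fun i => (List.finRange d).filterMap fun j =>
        if i.val < j.val then
          some (∀' (at' (Fin.last d) ⟹
            ∼(sub' (Fin.last d) i.castSucc ⊓ sub' (Fin.last d) j.castSucc)))
        else none) ⊓
      -- the least atom lies in `A₁`
      (∀' (isLeastAtom (Fin.last d) ⟹ sub' (Fin.last d) ((aIdx d 1 hd).castSucc))) ⊓
      -- immediate successors move cyclically through the `A_j`
      bigAnd ((List.finRange d).map fun j =>
        ∀' ∀' ((sub' ((Fin.last d).castSucc) (j.castSucc.castSucc) ⊓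
            isSuccOf (Fin.last (d + 1)) ((Fin.last d).castSucc)) ⟹
          sub' (Fin.last (d + 1)) ((cyc j).castSucc.castSucc))) ⊓
      -- the greatest atom lies in `A_h`
      (∀' (isGreatestAtom (Fin.last d) ⟹ sub' (Fin.last d) ((aIdx d h hd).castSucc))))
  else ⊥

/-- The list of formulas `xᵢ ≠ xⱼ` for `i < j < n`. -/
def distinctPairs (n : ℕ) : List (BF n) :=
  (List.finRange n).flatMap fun i => (List.finRange n).filterMap fun j =>
    if i.val < j.val then some (∼(eq' i j)) else none

/-- `ψ_{>n}` : there exist at least `n + 1` distinct atoms. -/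
def psiGt (n : ℕ) : Lmso.Sentence :=
  BoundedFormula.exs (n := n + 1)
    (bigAnd ((List.finRange (n + 1)).map fun i => at' i) ⊓ bigAnd (distinctPairs (n + 1)))

/-- `ψ_{=n}` : there exist exactly `n` distinct atoms. -/
def psiEq (n : ℕ) : Lmso.Sentence :=
  BoundedFormula.exs (n := n)
    (bigAnd ((List.finRange n).map fun i => at' i) ⊓ bigAnd (distinctPairs n) ⊓
      ∀' (at' (Fin.last n) ⟹ bigOr ((List.finRange n).map fun i => eq' (Fin.last n) i.castSucc)))

/-! ### Residue functions and the theories `T_r̃` -/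

/-- A residue function `ℙ × ℕ_{>0} → ℕ` (conditions imposed only at primes `p` and `j ≥ 1`):
`r(p,j) < p^j` and `r(p,j+1) ≡ r(p,j) [MOD p^j]`. -/
def IsResidueFunction (r : ℕ → ℕ → ℕ) : Prop :=
  ∀ p j : ℕ, p.Prime → 1 ≤ j → r p j < p ^ j ∧ r p (j + 1) ≡ r p j [MOD p ^ j]

/-- A function `ℕ_{>1} → ℕ` is a residue function if it arises from a residue function
`ℙ × ℕ_{>0} → ℕ` as in the paper (conditions imposed only for `d > 1`). -/
def IsResidueFunctionTilde (rt : ℕ → ℕ) : Prop :=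
  ∃ r : ℕ → ℕ → ℕ, IsResidueFunction r ∧
    ∀ d : ℕ, 1 < d → rt d < d ∧
      ∀ p j : ℕ, p.Prime → 1 ≤ j → p ^ j ∣ d → rt d ≡ r p j [MOD p ^ j]

/-- The theory `T_r̃ = T_MSO(Fin) ∪ {ψ_{>n} : n ∈ ℕ} ∪ {ρ_{d,r̃(d)} : d > 1}`. -/
def Trt (rt : ℕ → ℕ) : Lmso.Theory :=
  TMSOFin ∪ Set.range psiGt ∪ {σ : Lmso.Sentence | ∃ d : ℕ, 1 < d ∧ σ = rho d (rt d)}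

/-! ### Relativization and the sum of sentences -/

/-- Relativization of a formula to the elements `⊆ v`:
each quantifier `∀ Z (…)` becomes `∀ Z (Z ⊆ v → …)`. -/
def relv : ∀ {n : ℕ}, BF n → Fin n → BF n
  | _, BoundedFormula.falsum, _ => BoundedFormula.falsum
  | _, BoundedFormula.equal s t, _ => BoundedFormula.equal s t
  | _, BoundedFormula.rel r ts, _ => BoundedFormula.rel r ts
  | _, BoundedFormula.imp f g, v => (relv f v).imp (relv g v)
  | n, BoundedFormula.all f, v =>
      BoundedFormula.all (sub' (Fin.last n) v.castSucc ⟹ relv f v.castSucc)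

/-- `i` is downward closed with respect to the `≤ᴱ`-ordering of the atoms. -/
def dwcl' {n : ℕ} (i : Fin n) : BF n :=
  ∀' ∀' ((at' ((Fin.last n).castSucc) ⊓ at' (Fin.last (n + 1)) ⊓
      sub' ((Fin.last n).castSucc) (i.castSucc.castSucc) ⊓
      exle' (Fin.last (n + 1)) ((Fin.last n).castSucc)) ⟹
    sub' (Fin.last (n + 1)) (i.castSucc.castSucc))

/-- The sentence `φ + ψ` : `∃ X (X downward closed ∧ φ^X ∧ ψ^(Xᶜ))`
(with the complement `Xᶜ` introduced by an existential quantifier). -/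
def plusSent (φ ψ : Lmso.Sentence) : Lmso.Sentence :=
  ∃' ∃' (dwcl' (0 : Fin 2) ⊓ isComplOf (1 : Fin 2) (0 : Fin 2) ⊓
    relv (φ.liftAt 2 0) (0 : Fin 2) ⊓ relv (ψ.liftAt 2 0) (1 : Fin 2))

/-! ### `FSpec` and ultimate periodicity -/

/-- `FSpec φ` : the set of `n ∈ ℕ` such that `MSO(n) ⊨ φ`. -/
def FSpec (φ : Lmso.Sentence) : Set ℕ := {n : ℕ | MSOn n ⊨ φ}

/-- A set of naturals is ultimately periodic. -/
def UltPeriodic (S : Set ℕ) : Prop :=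
  ∃ N d : ℕ, 0 < d ∧ ∀ n : ℕ, N < n → (n ∈ S ↔ n + d ∈ S)

/-! ### The language `L_MO = {⊆, <}` -/

/-- The language `L_MO` with two binary relations: `⊆` (encoded `true`) and `<`
(encoded `false`). -/
def Lmo : Language where
  Functions := fun _ => Empty
  Relations := fun n => match n with | 2 => Bool | _ => Empty

/-- The monadic second order version `MSO(α)` of a linear order `α` as an `L_MO`-structure:
`⊆` is inclusion and `<` is the ordering of `α` on singletons. -/
instance moStructure (α : Type*) [LinearOrder α] : Lmo.Structure (Set α) where
  funMap := fun f _ => f.elim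
  RelMap := fun {n} r v => match n, r with
    | 2, true => v 0 ⊆ v 1
    | 2, false => ∃ a b : α, v 0 = {a} ∧ v 1 = {b} ∧ a < b


section Realize

variable {K : Type*} [Lmso.Structure K] {n : ℕ} {v : Empty → K} {xs : Fin n → K}

@[simp] theorem realize_tv (i : Fin n) :
    (tv i).realize (Sum.elim v xs) = xs i := rfl

@[simp] theorem realize_tb :
    (tb : Lmso.Term (Empty ⊕ Fin n)).realize (Sum.elim v xs) = botE K := by
  simp only [tb, Term.realize_constants]; rfl

@[simp] theorem realize_sub' (i j : Fin n) :
    (sub' i j).Realize v xs ↔ subE (xs i) (xs j) := by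
  simp only [sub', BoundedFormula.realize_rel₂, realize_tv]; rfl

@[simp] theorem realize_exle' (i j : Fin n) :
    (exle' i j).Realize v xs ↔ exleE (xs i) (xs j) := by
  simp only [exle', BoundedFormula.realize_rel₂, realize_tv]; rfl

@[simp] theorem realize_at' (i : Fin n) : (at' i).Realize v xs ↔ atE (xs i) := by
  simp only [at', BoundedFormula.realize_rel₁, realize_tv]; rfl

@[simp] theorem realize_eq' (i j : Fin n) : (eq' i j).Realize v xs ↔ xs i = xs j := by
  simp only [eq', BoundedFormula.realize_bdEqual, realize_tv]

@[simp] theorem realize_isBot' (i : Fin n) : (isBot' i).Realize v xs ↔ xs i = botE K := by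
  simp only [isBot', BoundedFormula.realize_bdEqual, realize_tv, realize_tb]

@[simp] theorem realize_botSub' (i : Fin n) :
    (botSub' i).Realize v xs ↔ subE (botE K) (xs i) := by
  simp only [botSub', BoundedFormula.realize_rel₂, realize_tv, realize_tb]; rfl

@[simp] theorem realize_isMeet (k i j : Fin n) :
    (isMeet k i j).Realize v xs ↔ subE (xs k) (xs i) ∧ subE (xs k) (xs j) ∧
      ∀ z, subE z (xs i) → subE z (xs j) → subE z (xs k) := by
  simp [isMeet, and_assoc]

@[simp] theorem realize_isJoin (k i j : Fin n) :
    (isJoin k i j).Realize v xs ↔ subE (xs i) (xs k) ∧ subE (xs j) (xs k) ∧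
      ∀ z, subE (xs i) z → subE (xs j) z → subE (xs k) z := by
  simp [isJoin, and_assoc]

@[simp] theorem realize_isComplOf (j i : Fin n) :
    (isComplOf j i).Realize v xs ↔
      (∀ z, subE z (xs i) → subE z (xs j) → z = botE K) ∧
        ∀ z, subE (xs i) z → subE (xs j) z → ∀ w, subE w z := by
  simp [isComplOf, meetIsBot, joinIsTop]

@[simp] theorem realize_isAtomDef (i : Fin n) :
    (isAtomDef i).Realize v xs ↔
      xs i ≠ botE K ∧ ∀ z, subE z (xs i) → z = botE K ∨ z = xs i := by
  simp [isAtomDef]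

@[simp] theorem realize_isLeastAtom (i : Fin n) :
    (isLeastAtom i).Realize v xs ↔ atE (xs i) ∧ ∀ z, atE z → ¬ exleE z (xs i) := by
  simp [isLeastAtom]

@[simp] theorem realize_isGreatestAtom (i : Fin n) :
    (isGreatestAtom i).Realize v xs ↔ atE (xs i) ∧ ∀ z, atE z → ¬ exleE (xs i) z := by
  simp [isGreatestAtom]

@[simp] theorem realize_isSuccOf (j i : Fin n) :
    (isSuccOf j i).Realize v xs ↔ atE (xs i) ∧ atE (xs j) ∧ exleE (xs i) (xs j) ∧
      ∀ z, atE z → exleE (xs i) z → z = xs j ∨ exleE (xs j) z := by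
  simp [isSuccOf, and_assoc]

@[simp] theorem realize_dwcl' (i : Fin n) :
    (dwcl' i).Realize v xs ↔ ∀ a b, atE a → atE b → subE a (xs i) → exleE b a →
      subE b (xs i) := by
  simp [dwcl']

end Realize

section Axioms

variable (K : Type*) [Lmso.Structure K]

theorem realize_axRefl : K ⊨ axRefl ↔ ∀ a : K, subE a a := by
  simp [axRefl, Sentence.Realize, Formula.Realize, Fin.snoc]

theorem realize_axAntisymm :
    K ⊨ axAntisymm ↔ ∀ a b : K, subE a b → subE b a → a = b := by
  simp [axAntisymm, Sentence.Realize, Formula.Realize, Fin.snoc]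

theorem realize_axTrans :
    K ⊨ axTrans ↔ ∀ a b c : K, subE a b → subE b c → subE a c := by
  simp [axTrans, Sentence.Realize, Formula.Realize, Fin.snoc]

theorem realize_axBotLe : K ⊨ axBotLe ↔ ∀ a : K, subE (botE K) a := by
  simp [axBotLe, Sentence.Realize, Formula.Realize, Fin.snoc]

theorem realize_axTop : K ⊨ axTop ↔ ∃ a : K, ∀ b, subE b a := by
  simp [axTop, Sentence.Realize, Formula.Realize, Fin.snoc]

theorem realize_axMeet : K ⊨ axMeet ↔ ∀ a b : K, ∃ c, subE c a ∧ subE c b ∧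
    ∀ z, subE z a → subE z b → subE z c := by
  simp [axMeet, Sentence.Realize, Formula.Realize, Fin.snoc]

theorem realize_axJoin : K ⊨ axJoin ↔ ∀ a b : K, ∃ c, subE a c ∧ subE b c ∧
    ∀ z, subE a z → subE b z → subE c z := by
  simp [axJoin, Sentence.Realize, Formula.Realize, Fin.snoc]

theorem realize_axCompl : K ⊨ axCompl ↔ ∀ a : K, ∃ b : K,
    (∀ z, subE z a → subE z b → z = botE K) ∧
      ∀ z, subE a z → subE b z → ∀ w, subE w z := by
  simp [axCompl, Sentence.Realize, Formula.Realize, Fin.snoc]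

theorem realize_axDistrib : K ⊨ axDistrib ↔ ∀ a b c ab ac bc l r : K,
    (subE ab a ∧ subE ab b ∧ ∀ z, subE z a → subE z b → subE z ab) →
    (subE ac a ∧ subE ac c ∧ ∀ z, subE z a → subE z c → subE z ac) →
    (subE b bc ∧ subE c bc ∧ ∀ z, subE b z → subE c z → subE bc z) →
    (subE l a ∧ subE l bc ∧ ∀ z, subE z a → subE z bc → subE z l) →
    (subE ab r ∧ subE ac r ∧ ∀ z, subE ab z → subE ac z → subE r z) → subE l r := by
  simp only [axDistrib, Sentence.Realize, Formula.Realize, BoundedFormula.realize_all,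
    BoundedFormula.realize_imp, BoundedFormula.realize_inf, realize_isMeet, realize_isJoin,
    realize_sub']
  exact ⟨fun h a b c ab ac bc l r h₁ h₂ h₃ h₄ h₅ =>
      h a b c ab ac bc l r ⟨⟨⟨⟨h₁, h₂⟩, h₃⟩, h₄⟩, h₅⟩,
    fun h a b c ab ac bc l r h' =>
      h a b c ab ac bc l r h'.1.1.1.1 h'.1.1.1.2 h'.1.1.2 h'.1.2 h'.2⟩

theorem realize_axAt : K ⊨ axAt ↔ ∀ a : K, atE a ↔
    (a ≠ botE K ∧ ∀ z, subE z a → z = botE K ∨ z = a) := by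
  simp [axAt, Sentence.Realize, Formula.Realize, Fin.snoc]

theorem realize_axAtomic : K ⊨ axAtomic ↔
    ∀ a : K, a ≠ botE K → ∃ b, atE b ∧ subE b a := by
  simp [axAtomic, Sentence.Realize, Formula.Realize, Fin.snoc]

theorem realize_axIrrefl : K ⊨ axIrrefl ↔ ∀ a : K, atE a → ¬ exleE a a := by
  simp [axIrrefl, Sentence.Realize, Formula.Realize, Fin.snoc]

theorem realize_axTransAt : K ⊨ axTransAt ↔
    ∀ a b c : K, atE a → atE b → atE c → exleE a b → exleE b c → exleE a c := by
  simp [axTransAt, Sentence.Realize, Formula.Realize, Fin.snoc]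

theorem realize_axTrich : K ⊨ axTrich ↔
    ∀ a b : K, atE a → atE b → exleE a b ∨ a = b ∨ exleE b a := by
  simp [axTrich, Sentence.Realize, Formula.Realize, Fin.snoc, or_assoc]

theorem realize_axExleDef : K ⊨ axExleDef ↔ ∀ a b : K, exleE a b ↔
    ∃ c d : K, atE c ∧ atE d ∧ subE c a ∧ subE d b ∧ exleE c d := by
  simp [axExleDef, Sentence.Realize, Formula.Realize, Fin.snoc, and_assoc]

theorem realize_axLeastAtom : K ⊨ axLeastAtom ↔
    ((∃ a : K, atE a) → ∃ a : K, atE a ∧ ∀ z, atE z → ¬ exleE z a) := by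
  simp [axLeastAtom, Sentence.Realize, Formula.Realize, Fin.snoc]

theorem realize_axGreatestAtom : K ⊨ axGreatestAtom ↔
    ((∃ a : K, atE a) → ∃ a : K, atE a ∧ ∀ z, atE z → ¬ exleE a z) := by
  simp [axGreatestAtom, Sentence.Realize, Formula.Realize, Fin.snoc]

theorem realize_axSucc : K ⊨ axSucc ↔ ∀ a : K, atE a → (∃ b, atE b ∧ exleE a b) →
    ∃ b, atE a ∧ atE b ∧ exleE a b ∧ ∀ z, atE z → exleE a z → z = b ∨ exleE b z := by
  simp [axSucc, Sentence.Realize, Formula.Realize, Fin.snoc]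

theorem realize_axPred : K ⊨ axPred ↔ ∀ a : K, atE a → (∃ b, atE b ∧ exleE b a) →
    ∃ b, atE b ∧ atE a ∧ exleE b a ∧ ∀ z, atE z → exleE b z → z = a ∨ exleE a z := by
  simp [axPred, Sentence.Realize, Formula.Realize, Fin.snoc]

theorem realize_axLeastIn : K ⊨ axLeastIn ↔ ∀ a : K, a ≠ botE K →
    ∃ b, atE b ∧ subE b a ∧ ∀ z, atE z → subE z a → ¬ exleE z b := by
  simp [axLeastIn, Sentence.Realize, Formula.Realize, Fin.snoc, and_assoc]

theorem realize_compAx {n : ℕ} (η : BF (n + 1)) : K ⊨ compAx η ↔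
    ∀ Y : Fin n → K, ∃ X : K, ∀ x : K, atE x →
      (subE x X ↔ η.Realize default (Fin.snoc Y x)) := by
  refine (BoundedFormula.realize_alls (v := default)).trans ?_
  simp only [BoundedFormula.realize_ex, BoundedFormula.realize_all, BoundedFormula.realize_imp,
    BoundedFormula.realize_iff, realize_at', realize_sub', Fin.snoc_last, Fin.snoc_castSucc]
  refine forall_congr' fun Y => exists_congr fun X => forall_congr' fun x => imp_congr_right
    fun _ => iff_congr Iff.rfl ?_
  rw [BoundedFormula.realize_liftAt (by omega)]
  refine iff_of_eq (congrArg _ ?_)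
  funext i
  refine Fin.lastCases ?_ (fun j => ?_) i
  · simp [Fin.snoc]
  · simp [Fin.snoc]

end Axioms

section Relativization

variable {K : Type*} [Lmso.Structure K]

theorem relv_castLE {m k : ℕ} (e : m = k) (h : m ≤ k) (f : BF m) (v : Fin k) :
    relv (f.castLE h) v = (relv f (Fin.cast e.symm v)).castLE h := by
  subst e
  simp

/-- Relativizing a formula to the elements below `X` amounts to evaluating it in the
substructure of these elements. -/
theorem realize_relv_liftAt (S : Lmso.Substructure K) (X : K) (hS : ∀ Z, Z ∈ S ↔ subE Z X)
    {n : ℕ} (φ : BF n) (v : Fin (n + 2)) (xs : Fin (n + 2) → K) (ys : Fin n → S)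
    (hv : xs v = X) (hxy : ∀ i : Fin n, xs (i.addNat 2) = ys i) :
    (relv (φ.liftAt 2 0) v).Realize default xs ↔ φ.Realize default ys := by
  have term : ∀ {n : ℕ} (t : Lmso.Term (Empty ⊕ Fin n)) (xs : Fin (n + 2) → K)
      (ys : Fin n → S), (∀ i : Fin n, xs (i.addNat 2) = ys i) →
      (t.liftAt 2 0).realize (Sum.elim default xs) =
        S.subtype (t.realize (Sum.elim default ys)) := by
    intro n t xs ys h
    rw [Term.realize_liftAt, ← HomClass.realize_term]
    congr 1
    funext i
    rcases i with i | i
    · exact i.elim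
    · simpa using h i
  induction φ with
  | falsum => exact Iff.rfl
  | equal t₁ t₂ =>
    change (t₁.liftAt 2 0).realize _ = (t₂.liftAt 2 0).realize _ ↔ _ = _
    rw [term t₁ xs ys hxy, term t₂ xs ys hxy]
    exact S.subtype.injective.eq_iff
  | rel R ts =>
    change Structure.RelMap R (fun i => ((ts i).liftAt 2 0).realize _) ↔
      Structure.RelMap R (fun i => (ts i).realize _)
    simp only [fun i => term (ts i) xs ys hxy]
    exact S.subtype.map_rel R _
  | imp f g ihf ihg =>
    exact imp_congr (ihf v xs ys hv hxy) (ihg v xs ys hv hxy)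
  | @all n f ih =>
    change (∀ z, ((sub' (Fin.last (n + 2)) v.castSucc) ⟹
      relv ((f.liftAt 2 0).castLE (by omega)) v.castSucc).Realize default (Fin.snoc xs z)) ↔
      ∀ z, f.Realize default (Fin.snoc ys z)
    simp only [BoundedFormula.realize_imp, realize_sub', Fin.snoc_last, Fin.snoc_castSucc, hv]
    have key : ∀ z : S, (relv ((f.liftAt 2 0).castLE
        (show n + 1 + 2 ≤ n + 2 + 1 by omega)) v.castSucc).Realize default (Fin.snoc xs z.1) ↔
        f.Realize default (Fin.snoc ys z) := by
      intro z
      rw [relv_castLE (by omega), BoundedFormula.realize_castLE_of_eq (by omega)]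
      apply ih
      · simp [hv, Fin.snoc]
      · intro i
        refine Fin.lastCases ?_ (fun j => ?_) i
        · simp [Fin.snoc]
        · have e : (j.castSucc.addNat 2) = Fin.cast (by omega) (j.addNat 2).castSucc := rfl
          simp only [e, Function.comp_apply, Fin.cast_eq_self, Fin.snoc_castSucc, hxy]
    exact ⟨fun h z => (key z).1 (h z ((hS _).1 z.2)),
      fun h z hz => (key ⟨z, (hS _).2 hz⟩).2 (h _)⟩

/-- The substructure of the elements below `X`. -/
def below (X : K) (hX : subE (botE K) X) : Lmso.Substructure K where
  carrier := {Z | subE Z X}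
  fun_mem := fun {n} f v _ => match n, f with
    | 0, f => by
      have : Structure.funMap f v = botE K := congrArg (Structure.funMap f) (Subsingleton.elim _ _)
      change subE (Structure.funMap f v) X
      rwa [this]

theorem realize_plusSent (φ ψ : Lmso.Sentence) : K ⊨ plusSent φ ψ ↔
    ∃ X Y : K, (∀ a b, atE a → atE b → subE a X → exleE b a → subE b X) ∧
      ((∀ z, subE z X → subE z Y → z = botE K) ∧
        ∀ z, subE X z → subE Y z → ∀ w, subE w z) ∧
      (relv (φ.liftAt 2 0) (0 : Fin 2)).Realize default ![X, Y] ∧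
      (relv (ψ.liftAt 2 0) (1 : Fin 2)).Realize default ![X, Y] := by
  have h : ∀ X Y : K, Fin.snoc (Fin.snoc (default : Fin 0 → K) X) Y = ![X, Y] := by
    intro X Y
    funext i
    fin_cases i <;> rfl
  refine (BoundedFormula.realize_ex).trans (exists_congr fun X =>
    BoundedFormula.realize_ex.trans (exists_congr fun Y => ?_))
  simp only [BoundedFormula.realize_inf, h, and_assoc, realize_dwcl', realize_isComplOf]
  rfl

theorem realize_relv_below (φ : Lmso.Sentence) (xs : Fin 2 → K) (i : Fin 2)
    (hX : subE (botE K) (xs i)) :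
    (relv (φ.liftAt 2 0) i).Realize default xs ↔ below (xs i) hX ⊨ φ :=
  realize_relv_liftAt (below (xs i) hX) (xs i) (fun _ => Iff.rfl) φ i xs default rfl
    (fun i => i.elim0)

end Relativization

section FefermanVaught

/-- A family of predicates on tuples of products `M ⊗ N` is rectangular if it is uniformly a
finite union of products of a definable predicate on `M` and a definable predicate on `N`. -/
def Rectangular {n : ℕ} (P : ∀ (M N : Type) [Lmso.Structure M] [Lmso.Structure N],
    (Fin n → M) → (Fin n → N) → Prop) : Prop :=
  ∃ l : List (BF n × BF n), ∀ (M N : Type) [Lmso.Structure M] [Lmso.Structure N]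
    (xs : Fin n → M) (ys : Fin n → N), P M N xs ys ↔
      ∃ p ∈ l, p.1.Realize default xs ∧ p.2.Realize default ys

namespace Rectangular

variable {n : ℕ} {P Q : ∀ (M N : Type) [Lmso.Structure M] [Lmso.Structure N],
    (Fin n → M) → (Fin n → N) → Prop}

theorem left (φ : BF n) : Rectangular fun _ _ _ _ xs _ => φ.Realize default xs :=
  ⟨[(φ, ⊤)], by simp⟩

theorem right (φ : BF n) : Rectangular fun _ _ _ _ _ ys => φ.Realize default ys :=
  ⟨[(⊤, φ)], by simp⟩

theorem or (hP : Rectangular P) (hQ : Rectangular Q) :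
    Rectangular fun M N _ _ xs ys => P M N xs ys ∨ Q M N xs ys := by
  obtain ⟨l, hl⟩ := hP
  obtain ⟨m, hm⟩ := hQ
  refine ⟨l ++ m, fun M N _ _ xs ys => ?_⟩
  simp only [hl, hm]
  simp only [List.mem_append, or_and_right, exists_or]

theorem and (hP : Rectangular P) (hQ : Rectangular Q) :
    Rectangular fun M N _ _ xs ys => P M N xs ys ∧ Q M N xs ys := by
  obtain ⟨l, hl⟩ := hP
  obtain ⟨m, hm⟩ := hQ
  refine ⟨(l ×ˢ m).map fun p => (p.1.1 ⊓ p.2.1, p.1.2 ⊓ p.2.2), fun M N _ _ xs ys => ?_⟩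
  simp only [hl, hm]
  constructor
  · rintro ⟨⟨p, hp, h₁, h₂⟩, q, hq, h₃, h₄⟩
    exact ⟨_, List.mem_map.2 ⟨(p, q), List.mem_product.2 ⟨hp, hq⟩, rfl⟩,
      BoundedFormula.realize_inf.2 ⟨h₁, h₃⟩, BoundedFormula.realize_inf.2 ⟨h₂, h₄⟩⟩
  · rintro ⟨_, hr, h₁, h₂⟩
    obtain ⟨⟨p, q⟩, hpq, rfl⟩ := List.mem_map.1 hr
    obtain ⟨hp, hq⟩ := List.mem_product.1 hpq
    rw [BoundedFormula.realize_inf] at h₁ h₂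
    exact ⟨⟨p, hp, h₁.1, h₂.1⟩, q, hq, h₁.2, h₂.2⟩

theorem not (hP : Rectangular P) : Rectangular fun M N _ _ xs ys => ¬ P M N xs ys := by
  obtain ⟨l, hl⟩ := hP
  simp only [hl]
  clear hl
  induction l with
  | nil => exact ⟨[(⊤, ⊤)], by simp⟩
  | cons p l ih =>
    obtain ⟨m, hm⟩ := ((left (∼p.1)).or (right (∼p.2))).and ih
    refine ⟨m, fun M N _ _ xs ys => ?_⟩
    rw [← hm]
    simp only [List.mem_cons, exists_eq_or_imp, BoundedFormula.realize_not]
    rw [not_or, not_and_or]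

theorem imp (hP : Rectangular P) (hQ : Rectangular Q) :
    Rectangular fun M N _ _ xs ys => P M N xs ys → Q M N xs ys := by
  obtain ⟨l, hl⟩ := hP.not.or hQ
  exact ⟨l, fun M N _ _ xs ys => by rw [← hl]; tauto⟩

theorem ex {P : ∀ (M N : Type) [Lmso.Structure M] [Lmso.Structure N],
    (Fin (n + 1) → M) → (Fin (n + 1) → N) → Prop} (hP : Rectangular P) :
    Rectangular fun M N _ _ xs ys => ∃ (a : M) (b : N), P M N (Fin.snoc xs a) (Fin.snoc ys b) := by
  obtain ⟨l, hl⟩ := hP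
  refine ⟨l.map fun p => (p.1.ex, p.2.ex), fun M N _ _ xs ys => ?_⟩
  simp only [hl]
  constructor
  · rintro ⟨a, b, p, hp, h₁, h₂⟩
    exact ⟨_, List.mem_map.2 ⟨p, hp, rfl⟩, BoundedFormula.realize_ex.2 ⟨a, h₁⟩,
      BoundedFormula.realize_ex.2 ⟨b, h₂⟩⟩
  · rintro ⟨_, hr, h₁, h₂⟩
    obtain ⟨p, hp, rfl⟩ := List.mem_map.1 hr
    obtain ⟨a, ha⟩ := BoundedFormula.realize_ex.1 h₁
    obtain ⟨b, hb⟩ := BoundedFormula.realize_ex.1 h₂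
    exact ⟨a, b, p, hp, ha, hb⟩

theorem all {P : ∀ (M N : Type) [Lmso.Structure M] [Lmso.Structure N],
    (Fin (n + 1) → M) → (Fin (n + 1) → N) → Prop} (hP : Rectangular P) :
    Rectangular fun M N _ _ xs ys => ∀ (a : M) (b : N), P M N (Fin.snoc xs a) (Fin.snoc ys b) := by
  obtain ⟨l, hl⟩ := hP.not.ex.not
  exact ⟨l, fun M N _ _ xs ys => by rw [← hl]; push Not; rfl⟩

end Rectangular

/-- Pairing of two tuples. -/
def pair {n : ℕ} {M N : Type*} (xs : Fin n → M) (ys : Fin n → N) : Fin n → M × N :=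
  fun i => (xs i, ys i)

theorem realize_term_pair {n : ℕ} {M N : Type*} [Lmso.Structure M] [Lmso.Structure N]
    (t : Lmso.Term (Empty ⊕ Fin n)) (xs : Fin n → M) (ys : Fin n → N) :
    t.realize (Sum.elim default (pair xs ys)) =
      (t.realize (Sum.elim default xs), t.realize (Sum.elim default ys)) := by
  cases t with
  | var i =>
    rcases i with i | i
    · exact i.elim
    · rfl
  | @func l f ts =>
    match l, f with
    | 0, f =>
      simp only [Term.realize]
      refine Prod.ext ?_ ?_ <;> exact congrArg (Structure.funMap f) (Subsingleton.elim _ _)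

theorem realize_term_snoc {n : ℕ} {M : Type*} [Lmso.Structure M]
    (t : Lmso.Term (Empty ⊕ Fin n)) (xs : Fin n → M) (a : M) :
    (t.relabel (Sum.map id Fin.castSucc)).realize (Sum.elim default (Fin.snoc xs a)) =
      t.realize (Sum.elim default xs) := by
  rw [Term.realize_relabel]
  congr 1
  funext i
  rcases i with i | i
  · rfl
  · simp

theorem snoc_pair {n : ℕ} {M N : Type*} (xs : Fin n → M) (ys : Fin n → N) (z : M × N) :
    (Fin.snoc (pair xs ys) z : Fin (n + 1) → M × N) =
      pair (Fin.snoc xs z.1) (Fin.snoc ys z.2) := by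
  funext i
  refine Fin.lastCases ?_ (fun j => ?_) i <;> simp [pair]

theorem rectangular_rel {n l : ℕ} (R : Lmso.Relations l)
    (ts : Fin l → Lmso.Term (Empty ⊕ Fin n)) :
    Rectangular fun M N _ _ xs ys =>
      (BoundedFormula.rel R ts).Realize (M := M × N) default (pair xs ys) := by
  simp only [BoundedFormula.Realize, realize_term_pair]
  match l, R with
  | 1, R =>
    let t := (ts 0).relabel (Sum.map id Fin.castSucc)
    obtain ⟨m, hm⟩ := (((Rectangular.left ((ts 0).bdEqual tb)).and
      (Rectangular.right ((ts 0).bdEqual tb))).not).and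
      (((Rectangular.left (subR.boundedFormula₂ (tv (Fin.last n)) t)).imp
        ((Rectangular.right (subR.boundedFormula₂ (tv (Fin.last n)) t)).imp
          (((Rectangular.left (isBot' (Fin.last n))).and
            (Rectangular.right (isBot' (Fin.last n)))).or
          ((Rectangular.left ((tv (Fin.last n)).bdEqual t)).and
            (Rectangular.right ((tv (Fin.last n)).bdEqual t)))))).all)
    refine ⟨m, fun M N _ _ xs ys => ?_⟩
    rw [← hm]
    simp only [BoundedFormula.realize_bdEqual, realize_tb, realize_isBot', realize_tv,
      BoundedFormula.realize_rel₂, t, realize_term_snoc, Fin.snoc_last, ← Prod.mk.injEq]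
    exact and_congr Iff.rfl Prod.forall
  | 2, true =>
    obtain ⟨m, hm⟩ := (Rectangular.left (subR.boundedFormula₂ (ts 0) (ts 1))).and
      (Rectangular.right (subR.boundedFormula₂ (ts 0) (ts 1)))
    refine ⟨m, fun M N _ _ xs ys => ?_⟩
    rw [← hm]
    simp only [BoundedFormula.realize_rel₂]
    rfl
  | 2, false =>
    obtain ⟨m, hm⟩ := ((Rectangular.left ((ts 0).bdEqual tb)).not.and
      (Rectangular.right ((ts 1).bdEqual tb)).not).or
      ((Rectangular.left (exleR.boundedFormula₂ (ts 0) (ts 1))).or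
      (Rectangular.right (exleR.boundedFormula₂ (ts 0) (ts 1))))
    refine ⟨m, fun M N _ _ xs ys => ?_⟩
    rw [← hm]
    simp only [BoundedFormula.realize_bdEqual, realize_tb, BoundedFormula.realize_rel₂]
    rfl

/-- Feferman–Vaught theorem for `⊗`. -/
theorem rectangular_realize {n : ℕ} (φ : BF n) :
    Rectangular fun M N _ _ xs ys => φ.Realize (M := M × N) default (pair xs ys) := by
  induction φ with
  | falsum => exact ⟨[], by simp [BoundedFormula.Realize]⟩
  | equal t₁ t₂ =>
    simp only [BoundedFormula.Realize, realize_term_pair, Prod.mk.injEq]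
    exact (Rectangular.left (t₁.bdEqual t₂)).and (Rectangular.right (t₁.bdEqual t₂))
  | rel R ts => exact rectangular_rel R ts
  | imp f g ihf ihg => exact ihf.imp ihg
  | all f ih =>
    simp only [BoundedFormula.Realize, Prod.forall, snoc_pair]
    exact ih.all

theorem fefermanVaught_sentence (χ : Lmso.Sentence) :
    ∃ l : List (Lmso.Sentence × Lmso.Sentence),
      ∀ (M N : Type) [Lmso.Structure M] [Lmso.Structure N],
        (M × N) ⊨ χ ↔ ∃ p ∈ l, M ⊨ p.1 ∧ N ⊨ p.2 := by
  obtain ⟨l, hl⟩ := rectangular_realize χ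
  refine ⟨l, fun M N _ _ => ?_⟩
  refine Iff.trans (iff_of_eq ?_) (hl M N default default)
  exact congrArg (BoundedFormula.Realize χ default) (Subsingleton.elim _ _)

end FefermanVaught

section Models

/-- Models of `T_MSO(Fin)`, described through the Boolean algebra they carry. -/
structure IsFinModel (K : Type*) [Lmso.Structure K] [BooleanAlgebra K] : Prop where
  sub (a b : K) : subE a b ↔ a ≤ b
  bot : botE K = ⊥
  atom (a : K) : atE a ↔ IsAtom a
  atomic (a : K) : a ≠ ⊥ → ∃ b, IsAtom b ∧ b ≤ a
  irrefl (a : K) : IsAtom a → ¬ exleE a a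
  trans (a b c : K) : IsAtom a → IsAtom b → IsAtom c → exleE a b → exleE b c → exleE a c
  trich (a b : K) : IsAtom a → IsAtom b → exleE a b ∨ a = b ∨ exleE b a
  exle (a b : K) : exleE a b ↔
    ∃ c d : K, IsAtom c ∧ IsAtom d ∧ c ≤ a ∧ d ≤ b ∧ exleE c d
  comp {n : ℕ} (η : BF (n + 1)) (Y : Fin n → K) :
    ∃ X : K, ∀ x : K, IsAtom x → (x ≤ X ↔ η.Realize default (Fin.snoc Y x))
  least : (∃ a : K, IsAtom a) → ∃ a : K, IsAtom a ∧ ∀ z, IsAtom z → ¬ exleE z a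
  greatest : (∃ a : K, IsAtom a) → ∃ a : K, IsAtom a ∧ ∀ z, IsAtom z → ¬ exleE a z
  succ (a : K) : IsAtom a → (∃ b, IsAtom b ∧ exleE a b) →
    ∃ b, IsAtom b ∧ exleE a b ∧ ∀ z, IsAtom z → exleE a z → z = b ∨ exleE b z
  pred (a : K) : IsAtom a → (∃ b, IsAtom b ∧ exleE b a) →
    ∃ b, IsAtom b ∧ exleE b a ∧ ∀ z, IsAtom z → exleE b z → z = a ∨ exleE a z
  leastIn (a : K) : a ≠ ⊥ →
    ∃ b, IsAtom b ∧ b ≤ a ∧ ∀ z, IsAtom z → z ≤ a → ¬ exleE z b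

variable {K : Type*} [Lmso.Structure K]

theorem exists_isFinModel (h : K ⊨ TMSOFin) : ∃ _ : BooleanAlgebra K, IsFinModel K := by
  have hK : ∀ φ ∈ TMSOFin, K ⊨ φ := fun φ hφ => h.realize_of_mem φ hφ
  have refl := (realize_axRefl K).1 (hK _ (by simp [TMSOFin, Tbase]))
  have antisymm := (realize_axAntisymm K).1 (hK _ (by simp [TMSOFin, Tbase]))
  have trans := (realize_axTrans K).1 (hK _ (by simp [TMSOFin, Tbase]))
  have botLe := (realize_axBotLe K).1 (hK _ (by simp [TMSOFin, Tbase]))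
  obtain ⟨top, leTop⟩ := (realize_axTop K).1 (hK _ (by simp [TMSOFin, Tbase]))
  choose meet hmeet using (realize_axMeet K).1 (hK _ (by simp [TMSOFin, Tbase]))
  choose join hjoin using (realize_axJoin K).1 (hK _ (by simp [TMSOFin, Tbase]))
  choose compl hcompl using (realize_axCompl K).1 (hK _ (by simp [TMSOFin, Tbase]))
  have distrib := (realize_axDistrib K).1 (hK _ (by simp [TMSOFin, Tbase]))
  let L : Lattice K :=
    { le := subE
      le_refl := refl
      le_trans := trans
      le_antisymm := antisymm
      inf := meet
      inf_le_left := fun a b => (hmeet a b).1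
      inf_le_right := fun a b => (hmeet a b).2.1
      le_inf := fun a b c h₁ h₂ => (hmeet b c).2.2 a h₁ h₂
      sup := join
      le_sup_left := fun a b => (hjoin a b).1
      le_sup_right := fun a b => (hjoin a b).2.1
      sup_le := fun a b c h₁ h₂ => (hjoin a b).2.2 c h₁ h₂ }
  let D : DistribLattice K := DistribLattice.ofInfSupLe fun a b c =>
    distrib a b c _ _ _ _ _ (hmeet a b) (hmeet a c) (hjoin b c) (hmeet a _) (hjoin _ _)
  let B : BooleanAlgebra K :=
    { D with
      compl := compl
      bot := botE K
      top := top
      bot_le := botLe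
      le_top := leTop
      inf_compl_le_bot := fun a =>
        le_of_eq ((hcompl a).1 _ (hmeet a (compl a)).1 (hmeet a (compl a)).2.1)
      top_le_sup_compl := fun a =>
        (hcompl a).2 _ (hjoin a (compl a)).1 (hjoin a (compl a)).2.1 _ }
  have sub (a b : K) : subE a b ↔ a ≤ b := Iff.rfl
  have bot : botE K = ⊥ := rfl
  have atom (a : K) : atE a ↔ IsAtom a := by
    rw [(realize_axAt K).1 (hK _ (by simp [TMSOFin, Tbase])) a]
    refine and_congr Iff.rfl (forall_congr' fun z => ?_)
    rw [lt_iff_le_and_ne, and_imp, sub, bot]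
    tauto
  have atomic := (realize_axAtomic K).1 (hK _ (by simp [TMSOFin, Tbase]))
  have irrefl := (realize_axIrrefl K).1 (hK _ (by simp [TMSOFin, Tbase]))
  have transAt := (realize_axTransAt K).1 (hK _ (by simp [TMSOFin, Tbase]))
  have trich := (realize_axTrich K).1 (hK _ (by simp [TMSOFin, Tbase]))
  have exle := (realize_axExleDef K).1 (hK _ (by simp [TMSOFin, Tbase]))
  have least := (realize_axLeastAtom K).1 (hK _ (by simp [TMSOFin]))
  have greatest := (realize_axGreatestAtom K).1 (hK _ (by simp [TMSOFin]))
  have succ := (realize_axSucc K).1 (hK _ (by simp [TMSOFin]))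
  have pred := (realize_axPred K).1 (hK _ (by simp [TMSOFin]))
  have leastIn := (realize_axLeastIn K).1 (hK _ (by simp [TMSOFin]))
  have comp {n : ℕ} (η : BF (n + 1)) := (realize_compAx K η).1
    (hK _ (Or.inl (Or.inr (Set.mem_iUnion.2 ⟨n, η, rfl⟩))))
  simp only [sub, bot, atom] at atomic irrefl transAt trich exle least greatest succ pred leastIn
  exact ⟨B, sub, bot, atom, atomic, irrefl, transAt, trich, exle,
    fun η Y => by simpa only [sub, atom] using comp η Y, least, greatest,
    fun a ha hb => (succ a ha hb).imp fun _ h => h.2,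
    fun a ha hb => (pred a ha hb).imp fun _ h => ⟨h.1, h.2.2⟩, leastIn⟩

theorem IsFinModel.model [BooleanAlgebra K] (h : IsFinModel K) : K ⊨ TMSOFin := by
  rw [Theory.model_iff]
  intro φ hφ
  have isMeet {a b c : K} (hc : c ≤ a ∧ c ≤ b ∧ ∀ z, z ≤ a → z ≤ b → z ≤ c) : c = a ⊓ b :=
    le_antisymm (le_inf hc.1 hc.2.1) (hc.2.2 _ inf_le_left inf_le_right)
  have isJoin {a b c : K} (hc : a ≤ c ∧ b ≤ c ∧ ∀ z, a ≤ z → b ≤ z → c ≤ z) : c = a ⊔ b :=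
    le_antisymm (hc.2.2 _ le_sup_left le_sup_right) (sup_le hc.1 hc.2.1)
  rcases hφ with (hφ | hφ) | hφ
  · simp only [Set.mem_insert_iff, Set.mem_singleton_iff] at hφ
    rcases hφ with rfl | rfl | rfl | rfl | rfl | rfl | rfl | rfl | rfl | rfl | rfl | rfl | rfl |
      rfl | rfl
    · simp only [realize_axRefl, h.sub]
      exact le_refl
    · simp only [realize_axAntisymm, h.sub]
      exact fun _ _ => le_antisymm
    · simp only [realize_axTrans, h.sub]
      exact fun _ _ _ => le_trans
    · simp only [realize_axBotLe, h.sub, h.bot]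
      exact fun _ => bot_le
    · simp only [realize_axTop, h.sub]
      exact ⟨⊤, fun _ => le_top⟩
    · simp only [realize_axMeet, h.sub]
      exact fun a b => ⟨a ⊓ b, inf_le_left, inf_le_right, fun _ => le_inf⟩
    · simp only [realize_axJoin, h.sub]
      exact fun a b => ⟨a ⊔ b, le_sup_left, le_sup_right, fun _ => sup_le⟩
    · simp only [realize_axCompl, h.sub, h.bot]
      exact fun a => ⟨aᶜ, fun z h₁ h₂ => le_bot_iff.1 (inf_compl_eq_bot (a := a) ▸ le_inf h₁ h₂),
        fun z h₁ h₂ w => le_top.trans (sup_compl_eq_top (x := a) ▸ sup_le h₁ h₂)⟩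
    · simp only [realize_axDistrib, h.sub]
      intro a b c ab ac bc l r h₁ h₂ h₃ h₄ h₅
      rw [isJoin h₅, isMeet h₄, isJoin h₃, isMeet h₂, isMeet h₁, inf_sup_left]
    · simp only [realize_axAt, h.sub, h.atom, h.bot]
      refine fun a => and_congr Iff.rfl (forall_congr' fun z => ?_)
      rw [lt_iff_le_and_ne, and_imp]
      tauto
    · simpa only [realize_axAtomic, h.sub, h.atom, h.bot] using h.atomic
    · simpa only [realize_axIrrefl, h.atom] using h.irrefl
    · simpa only [realize_axTransAt, h.atom] using h.trans
    · simpa only [realize_axTrich, h.atom] using h.trich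
    · simpa only [realize_axExleDef, h.sub, h.atom] using h.exle
  · obtain ⟨n, η, rfl⟩ := Set.mem_iUnion.1 hφ
    simpa only [realize_compAx, h.sub, h.atom] using h.comp η
  · simp only [Set.mem_insert_iff, Set.mem_singleton_iff] at hφ
    rcases hφ with rfl | rfl | rfl | rfl | rfl
    · simpa only [realize_axLeastAtom, h.atom] using h.least
    · simpa only [realize_axGreatestAtom, h.atom] using h.greatest
    · simp only [realize_axSucc, h.atom]
      exact fun a ha hb => (h.succ a ha hb).imp fun _ h => ⟨ha, h⟩
    · simp only [realize_axPred, h.atom]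
      exact fun a ha hb => (h.pred a ha hb).imp fun _ h => ⟨h.1, ha, h.2⟩
    · simpa only [realize_axLeastIn, h.sub, h.atom, h.bot] using h.leastIn

namespace IsFinModel

variable [BooleanAlgebra K]

theorem not_exle_bot_left (h : IsFinModel K) (a : K) : ¬ exleE ⊥ a := by
  rw [h.exle]
  rintro ⟨c, d, hc, -, hc', -⟩
  exact hc.1 (le_bot_iff.1 hc')

theorem not_exle_bot_right (h : IsFinModel K) (a : K) : ¬ exleE a ⊥ := by
  rw [h.exle]
  rintro ⟨c, d, -, hd, -, hd', -⟩
  exact hd.1 (le_bot_iff.1 hd')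

end IsFinModel

end Models

section Tensor

theorem isAtom_prod_iff {M N : Type*} [BooleanAlgebra M] [BooleanAlgebra N] (p : M × N) :
    IsAtom p ↔ (IsAtom p.1 ∧ p.2 = ⊥) ∨ (p.1 = ⊥ ∧ IsAtom p.2) := by
  constructor
  · intro h
    by_cases h₁ : p.1 = ⊥
    · refine Or.inr ⟨h₁, fun h₂ => h.1 (Prod.ext h₁ h₂), fun b hb => ?_⟩
      have : ((⊥, b) : M × N) = ⊥ := h.2 _ (lt_of_le_of_ne ⟨bot_le, hb.le⟩
        fun e => hb.ne (congrArg Prod.snd e))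
      exact congrArg Prod.snd this
    · refine Or.inl ⟨⟨h₁, fun a ha => ?_⟩, ?_⟩
      · have : ((a, ⊥) : M × N) = ⊥ := h.2 _ (lt_of_le_of_ne ⟨ha.le, bot_le⟩
          fun e => ha.ne (congrArg Prod.fst e))
        exact congrArg Prod.fst this
      · rcases h.le_iff.1 (show ((p.1, ⊥) : M × N) ≤ p from ⟨le_rfl, bot_le⟩) with e | e
        · exact (h₁ (congrArg Prod.fst e)).elim
        · exact (congrArg Prod.snd e).symm
  · rcases p with ⟨a, b⟩
    rintro (⟨h, rfl⟩ | ⟨rfl, h⟩)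
    · refine ⟨fun e => h.1 (congrArg Prod.fst e), fun q hq => ?_⟩
      have h₂ : q.2 = ⊥ := le_bot_iff.1 hq.le.2
      refine Prod.ext ((h.le_iff.1 hq.le.1).resolve_right fun e => hq.ne (Prod.ext e h₂)) h₂
    · refine ⟨fun e => h.1 (congrArg Prod.snd e), fun q hq => ?_⟩
      have h₁ : q.1 = ⊥ := le_bot_iff.1 hq.le.1
      refine Prod.ext h₁ ((h.le_iff.1 hq.le.2).resolve_right fun e => hq.ne (Prod.ext h₁ e))

theorem forall_isAtom_prod {M N : Type*} [BooleanAlgebra M] [BooleanAlgebra N] {P : M × N → Prop} :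
    (∀ p, IsAtom p → P p) ↔ (∀ a, IsAtom a → P (a, ⊥)) ∧ ∀ b, IsAtom b → P (⊥, b) := by
  simp only [isAtom_prod_iff, Prod.forall]
  constructor
  · exact fun h => ⟨fun a ha => h a ⊥ (Or.inl ⟨ha, rfl⟩), fun b hb => h ⊥ b (Or.inr ⟨rfl, hb⟩)⟩
  · rintro ⟨h₁, h₂⟩ a b (⟨h, rfl⟩ | ⟨rfl, h⟩)
    exacts [h₁ a h, h₂ b h]

theorem exists_isAtom_prod {M N : Type*} [BooleanAlgebra M] [BooleanAlgebra N] {P : M × N → Prop} :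
    (∃ p, IsAtom p ∧ P p) ↔ (∃ a, IsAtom a ∧ P (a, ⊥)) ∨ ∃ b, IsAtom b ∧ P (⊥, b) := by
  simp only [isAtom_prod_iff, Prod.exists]
  constructor
  · rintro ⟨a, b, (⟨h, rfl⟩ | ⟨rfl, h⟩), hp⟩
    exacts [Or.inl ⟨a, h, hp⟩, Or.inr ⟨b, h, hp⟩]
  · rintro (⟨a, h, hp⟩ | ⟨b, h, hp⟩)
    exacts [⟨a, ⊥, Or.inl ⟨h, rfl⟩, hp⟩, ⟨⊥, b, Or.inr ⟨rfl, h⟩, hp⟩]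

variable {M N : Type} [Lmso.Structure M] [Lmso.Structure N] [BooleanAlgebra M] [BooleanAlgebra N]

theorem exleE_prod (hM : IsFinModel M) (hN : IsFinModel N) (p q : M × N) :
    exleE p q ↔ (p.1 ≠ ⊥ ∧ q.2 ≠ ⊥) ∨ exleE p.1 q.1 ∨ exleE p.2 q.2 := by
  rw [← hM.bot, ← hN.bot]
  rfl

theorem exists_formula_of_list {n : ℕ} (l : List (BF n × BF n)) (c : BF n → Prop) :
    ∃ θ : BF n, ∀ (K : Type) [Lmso.Structure K] (xs : Fin n → K),
      θ.Realize default xs ↔ ∃ p ∈ l, p.1.Realize default xs ∧ c p.2 := by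
  induction l with
  | nil => exact ⟨⊥, by simp⟩
  | cons p l ih =>
    obtain ⟨θ, hθ⟩ := ih
    by_cases hp : c p.2
    · exact ⟨p.1 ⊔ θ, fun K _ xs => by simp [hθ, hp]⟩
    · exact ⟨θ, fun K _ xs => by simp [hθ, hp]⟩

theorem exists_formula_of_list' {n : ℕ} (l : List (BF n × BF n)) (c : BF n → Prop) :
    ∃ θ : BF n, ∀ (K : Type) [Lmso.Structure K] (xs : Fin n → K),
      θ.Realize default xs ↔ ∃ p ∈ l, c p.1 ∧ p.2.Realize default xs := by
  obtain ⟨θ, hθ⟩ := exists_formula_of_list (l.map Prod.swap) c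
  refine ⟨θ, fun K _ xs => ?_⟩
  rw [hθ]
  constructor
  · rintro ⟨_, hp, h₁, h₂⟩
    obtain ⟨q, hq, rfl⟩ := List.mem_map.1 hp
    exact ⟨q, hq, h₂, h₁⟩
  · rintro ⟨p, hp, h₁, h₂⟩
    exact ⟨p.swap, List.mem_map.2 ⟨p, hp, rfl⟩, h₂, h₁⟩

theorem comprehension_prod (hM : IsFinModel M) (hN : IsFinModel N) {n : ℕ} (η : BF (n + 1))
    (Y : Fin n → M × N) :
    ∃ X : M × N, ∀ x, IsAtom x → (x ≤ X ↔ η.Realize default (Fin.snoc Y x)) := by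
  obtain ⟨l, hl⟩ := rectangular_realize η
  obtain ⟨θ, hθ⟩ := exists_formula_of_list l
    fun ψ => ψ.Realize default (Fin.snoc (Prod.snd ∘ Y) ⊥ : Fin (n + 1) → N)
  obtain ⟨ζ, hζ⟩ := exists_formula_of_list' l
    fun ψ => ψ.Realize default (Fin.snoc (Prod.fst ∘ Y) ⊥ : Fin (n + 1) → M)
  obtain ⟨X, hX⟩ := hM.comp θ (Prod.fst ∘ Y)
  obtain ⟨Z, hZ⟩ := hN.comp ζ (Prod.snd ∘ Y)
  have key (z : M × N) : η.Realize default (Fin.snoc Y z) ↔ ∃ p ∈ l,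
      p.1.Realize default (Fin.snoc (Prod.fst ∘ Y) z.1 : Fin (n + 1) → M) ∧
      p.2.Realize default (Fin.snoc (Prod.snd ∘ Y) z.2 : Fin (n + 1) → N) := by
    rw [← hl]
    exact iff_of_eq (congrArg _ (snoc_pair (Prod.fst ∘ Y) (Prod.snd ∘ Y) z))
  refine ⟨(X, Z), forall_isAtom_prod.2 ⟨fun a ha => ?_, fun b hb => ?_⟩⟩
  · simp only [key, Prod.mk_le_mk, bot_le, and_true, hX a ha, hθ]
  · simp only [key, Prod.mk_le_mk, bot_le, true_and, hZ b hb, hζ]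

theorem isFinModel_prod (hM : IsFinModel M) (hN : IsFinModel N) : IsFinModel (M × N) := by
  have hsub (p q : M × N) : subE p q ↔ p ≤ q := by
    rw [Prod.le_def, ← hM.sub, ← hN.sub]
    rfl
  have exle₁₁ (a a' : M) : exleE (a, (⊥ : N)) (a', ⊥) ↔ exleE a a' := by
    simp [exleE_prod hM hN, hN.not_exle_bot_left]
  have exle₂₂ (b b' : N) : exleE ((⊥ : M), b) (⊥, b') ↔ exleE b b' := by
    simp [exleE_prod hM hN, hM.not_exle_bot_left]
  have exle₁₂ (a : M) (b : N) (ha : IsAtom a) (hb : IsAtom b) : exleE (a, (⊥ : N)) (⊥, b) := by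
    simp [exleE_prod hM hN, ha.1, hb.1]
  have exle₂₁ (a : M) (b : N) : ¬ exleE ((⊥ : M), b) (a, ⊥) := by
    simp [exleE_prod hM hN, hM.not_exle_bot_left, hN.not_exle_bot_right]
  exact
  { sub := hsub
    bot := Prod.ext hM.bot hN.bot
    atom := by
      intro p
      have hb : (botE M, botE N) = (⊥ : M × N) := Prod.ext hM.bot hN.bot
      change (p ≠ (botE M, botE N) ∧ ∀ q : M × N, subE q.1 p.1 → subE q.2 p.2 →
        q = (botE M, botE N) ∨ q = p) ↔ _
      rw [hb]
      refine and_congr Iff.rfl (forall_congr' fun q => ?_)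
      rw [hM.sub, hN.sub, lt_iff_le_and_ne, Prod.le_def]
      tauto
    atomic := by
      intro p hp
      rw [exists_isAtom_prod]
      by_cases h : p.1 = ⊥
      · obtain ⟨b, hb, hbp⟩ := hN.atomic p.2 fun h' => hp (Prod.ext h h')
        exact Or.inr ⟨b, hb, bot_le, hbp⟩
      · obtain ⟨a, ha, hap⟩ := hM.atomic p.1 h
        exact Or.inl ⟨a, ha, hap, bot_le⟩
    irrefl := by
      rw [forall_isAtom_prod]
      simp only [exle₁₁, exle₂₂]
      exact ⟨hM.irrefl, hN.irrefl⟩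
    trans := by
      rintro ⟨a, b⟩ ⟨a', b'⟩ ⟨a'', b''⟩ hp hq hr
      rw [isAtom_prod_iff] at hp hq hr
      rcases hp with ⟨h₁, rfl⟩ | ⟨rfl, h₁⟩ <;> rcases hq with ⟨h₂, rfl⟩ | ⟨rfl, h₂⟩ <;>
        rcases hr with ⟨h₃, rfl⟩ | ⟨rfl, h₃⟩
      · simpa only [exle₁₁] using hM.trans _ _ _ h₁ h₂ h₃
      · exact fun _ _ => exle₁₂ _ _ h₁ h₃
      · exact fun _ h => (exle₂₁ _ _ h).elim
      · exact fun _ _ => exle₁₂ _ _ h₁ h₃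
      · exact fun h => (exle₂₁ _ _ h).elim
      · exact fun h => (exle₂₁ _ _ h).elim
      · exact fun _ h => (exle₂₁ _ _ h).elim
      · simpa only [exle₂₂] using hN.trans _ _ _ h₁ h₂ h₃
    trich := by
      rintro ⟨a, b⟩ ⟨a', b'⟩ hp hq
      rw [isAtom_prod_iff] at hp hq
      rcases hp with ⟨h₁, rfl⟩ | ⟨rfl, h₁⟩ <;> rcases hq with ⟨h₂, rfl⟩ | ⟨rfl, h₂⟩
      · simpa [exle₁₁] using hM.trich _ _ h₁ h₂
      · exact Or.inl (exle₁₂ _ _ h₁ h₂)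
      · exact Or.inr (Or.inr (exle₁₂ _ _ h₂ h₁))
      · simpa [exle₂₂] using hN.trich _ _ h₁ h₂
    exle := by
      rintro ⟨a, b⟩ ⟨c, d⟩
      constructor
      · rw [exleE_prod hM hN]
        rintro (⟨h₁, h₂⟩ | h | h)
        · obtain ⟨e, he, hea⟩ := hM.atomic _ h₁
          obtain ⟨f, hf, hfd⟩ := hN.atomic _ h₂
          exact ⟨(e, ⊥), (⊥, f), (isAtom_prod_iff _).2 (Or.inl ⟨he, rfl⟩),
            (isAtom_prod_iff _).2 (Or.inr ⟨rfl, hf⟩), ⟨hea, bot_le⟩, ⟨bot_le, hfd⟩,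
            exle₁₂ _ _ he hf⟩
        · obtain ⟨e, f, he, hf, hea, hfc, hef⟩ := (hM.exle _ _).1 h
          exact ⟨(e, ⊥), (f, ⊥), (isAtom_prod_iff _).2 (Or.inl ⟨he, rfl⟩),
            (isAtom_prod_iff _).2 (Or.inl ⟨hf, rfl⟩), ⟨hea, bot_le⟩, ⟨hfc, bot_le⟩,
            (exle₁₁ _ _).2 hef⟩
        · obtain ⟨e, f, he, hf, hea, hfc, hef⟩ := (hN.exle _ _).1 h
          exact ⟨(⊥, e), (⊥, f), (isAtom_prod_iff _).2 (Or.inr ⟨rfl, he⟩),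
            (isAtom_prod_iff _).2 (Or.inr ⟨rfl, hf⟩), ⟨bot_le, hea⟩, ⟨bot_le, hfc⟩,
            (exle₂₂ _ _).2 hef⟩
      · rintro ⟨⟨e, e'⟩, ⟨f, f'⟩, -, -, ⟨h₁, h₂⟩, ⟨h₃, h₄⟩, h⟩
        rw [exleE_prod hM hN] at h ⊢
        simp only at h h₁ h₂ h₃ h₄ ⊢
        refine Or.imp (fun h => ⟨fun h' => h.1 (le_bot_iff.1 (h' ▸ h₁)),
          fun h' => h.2 (le_bot_iff.1 (h' ▸ h₄))⟩) (Or.imp (fun h => ?_) fun h => ?_) h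
        · obtain ⟨x, y, hx, hy, hxe, hyf, hxy⟩ := (hM.exle _ _).1 h
          exact (hM.exle _ _).2 ⟨x, y, hx, hy, hxe.trans h₁, hyf.trans h₃, hxy⟩
        · obtain ⟨x, y, hx, hy, hxe, hyf, hxy⟩ := (hN.exle _ _).1 h
          exact (hN.exle _ _).2 ⟨x, y, hx, hy, hxe.trans h₂, hyf.trans h₄, hxy⟩
    comp := comprehension_prod hM hN
    least := by
      intro hp
      simp only [exists_isAtom_prod, forall_isAtom_prod, exle₁₁, exle₂₂]
      by_cases h : ∃ a : M, IsAtom a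
      · obtain ⟨a, ha, ha'⟩ := hM.least h
        exact Or.inl ⟨a, ha, ha', fun b _ => exle₂₁ a b⟩
      · have hb : ∃ b : N, IsAtom b := by
          obtain ⟨p, hp⟩ := hp
          rcases (isAtom_prod_iff p).1 hp with h' | h'
          exacts [(h ⟨_, h'.1⟩).elim, ⟨_, h'.2⟩]
        obtain ⟨b, hb, hb'⟩ := hN.least hb
        exact Or.inr ⟨b, hb, fun a ha => (h ⟨a, ha⟩).elim, hb'⟩
    greatest := by
      intro hp
      simp only [exists_isAtom_prod, forall_isAtom_prod, exle₁₁, exle₂₂]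
      by_cases h : ∃ b : N, IsAtom b
      · obtain ⟨b, hb, hb'⟩ := hN.greatest h
        exact Or.inr ⟨b, hb, fun a _ => exle₂₁ a b, hb'⟩
      · have ha : ∃ a : M, IsAtom a := by
          obtain ⟨p, hp⟩ := hp
          rcases (isAtom_prod_iff p).1 hp with h' | h'
          exacts [⟨_, h'.1⟩, (h ⟨_, h'.2⟩).elim]
        obtain ⟨a, ha, ha'⟩ := hM.greatest ha
        exact Or.inl ⟨a, ha, ha', fun b hb => (h ⟨b, hb⟩).elim⟩
    succ := by
      simp only [exists_isAtom_prod, forall_isAtom_prod, exle₁₁, exle₂₂, exle₂₁, Prod.mk.injEq,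
        and_true, true_and, false_imp_iff, imp_true_iff, false_and, and_false, exists_false,
        false_or]
      refine ⟨fun a ha h => ?_, fun b hb h => ?_⟩
      · by_cases h' : ∃ a', IsAtom a' ∧ exleE a a'
        · obtain ⟨c, hc, hac, hc'⟩ := hM.succ a ha h'
          exact Or.inl ⟨c, hc, hac, hc', fun b hb _ => Or.inr (exle₁₂ _ _ hc hb)⟩
        · have hb : ∃ b : N, IsAtom b := by
            rcases h with h | ⟨b, hb, -⟩
            exacts [(h' h).elim, ⟨b, hb⟩]
          obtain ⟨b, hb, hb'⟩ := hN.least hb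
          refine Or.inr ⟨b, hb, exle₁₂ _ _ ha hb, fun a' ha' h => (h' ⟨a', ha', h⟩).elim,
            fun c hc _ => ?_⟩
          rcases hN.trich c b hc hb with h | h | h
          exacts [(hb' c hc h).elim, Or.inl h, Or.inr h]
      · exact hN.succ b hb h
    pred := by
      simp only [exists_isAtom_prod, forall_isAtom_prod, exle₁₁, exle₂₂, exle₂₁, Prod.mk.injEq,
        and_true, true_and, false_imp_iff, imp_true_iff, false_and, and_false, exists_false,
        or_false]
      refine ⟨fun a ha h => ?_, fun b hb h => ?_⟩
      · obtain ⟨c, hc, hca, hc'⟩ := hM.pred a ha h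
        exact ⟨c, hc, hca, hc', fun b hb _ => Or.inr (exle₁₂ _ _ ha hb)⟩
      · by_cases h' : ∃ b', IsAtom b' ∧ exleE b' b
        · obtain ⟨c, hc, hcb, hc'⟩ := hN.pred b hb h'
          exact Or.inr ⟨c, hc, hcb, hc'⟩
        · have ha : ∃ a : M, IsAtom a := by
            rcases h with ⟨a, ha, -⟩ | h
            exacts [⟨a, ha⟩, (h' h).elim]
          obtain ⟨a, ha, ha'⟩ := hM.greatest ha
          refine Or.inl ⟨a, ha, exle₁₂ _ _ ha hb, fun c hc h => (ha' c hc h).elim,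
            fun c hc _ => ?_⟩
          rcases hN.trich c b hc hb with h | h | h
          exacts [(h' ⟨c, hc, h⟩).elim, Or.inl h, Or.inr h]
    leastIn := by
      rintro ⟨c, d⟩ hp
      simp only [exists_isAtom_prod, forall_isAtom_prod, exle₁₁, exle₂₂, Prod.mk_le_mk, bot_le,
        and_true, true_and]
      by_cases h : c = ⊥
      · obtain ⟨b, hb, hbd, hb'⟩ := hN.leastIn d fun h' => hp (Prod.ext h h')
        exact Or.inr ⟨b, hb, hbd, fun a ha hac => (ha.1 (le_bot_iff.1 (h ▸ hac))).elim, hb'⟩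
      · obtain ⟨a, ha, hac, ha'⟩ := hM.leastIn c h
        exact Or.inl ⟨a, ha, hac, ha', fun b _ _ => exle₂₁ a b⟩ }

end Tensor

section Sum

/-- An isomorphism of `L_⊗`-structures from a bijection preserving the basic notions. -/
def equivOfPreserves {A B : Type*} [Lmso.Structure A] [Lmso.Structure B] (e : A ≃ B)
    (hbot : e (botE A) = botE B) (hat : ∀ a, atE (e a) ↔ atE a)
    (hsub : ∀ a b, subE (e a) (e b) ↔ subE a b)
    (hexle : ∀ a b, exleE (e a) (e b) ↔ exleE a b) : A ≃[Lmso] B where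
  toEquiv := e
  map_fun' := fun {n} f x => match n, f with
    | 0, f => by
      have h₁ : Structure.funMap f x = botE A := congrArg (Structure.funMap f) (Subsingleton.elim _ _)
      have h₂ : Structure.funMap f (e ∘ x) = botE B :=
        congrArg (Structure.funMap f) (Subsingleton.elim _ _)
      exact (congrArg e h₁).trans (hbot.trans h₂.symm)
  map_rel' := fun {n} r x => match n, r with
    | 1, r => by
      obtain ⟨a, rfl⟩ : ∃ a, x = ![a] := ⟨x 0, by ext i; fin_cases i; rfl⟩
      have h : (e ∘ ![a] : Fin 1 → B) = ![e a] := by ext i; fin_cases i; rfl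
      change Structure.RelMap r (e ∘ ![a]) ↔ _
      rw [h]
      exact hat a
    | 2, true => by
      obtain ⟨a, b, rfl⟩ : ∃ a b, x = ![a, b] := ⟨x 0, x 1, by ext i; fin_cases i <;> rfl⟩
      have h : (e ∘ ![a, b] : Fin 2 → B) = ![e a, e b] := by ext i; fin_cases i <;> rfl
      change Structure.RelMap subR (e ∘ ![a, b]) ↔ _
      rw [h]
      exact hsub a b
    | 2, false => by
      obtain ⟨a, b, rfl⟩ : ∃ a b, x = ![a, b] := ⟨x 0, x 1, by ext i; fin_cases i <;> rfl⟩
      have h : (e ∘ ![a, b] : Fin 2 → B) = ![e a, e b] := by ext i; fin_cases i <;> rfl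
      change Structure.RelMap exleR (e ∘ ![a, b]) ↔ _
      rw [h]
      exact hexle a b

section Substructure

variable {K : Type*} [Lmso.Structure K] (S : Lmso.Substructure K)

theorem coe_botE : ((botE S : S) : K) = botE K :=
  congrArg (Structure.funMap botC) (Subsingleton.elim _ _)

theorem atE_coe (a : S) : atE a ↔ atE (a : K) := by
  refine (S.subtype.map_rel atR ![a]).symm.trans (iff_of_eq (congrArg _ ?_))
  ext i; fin_cases i; rfl

theorem subE_coe (a b : S) : subE a b ↔ subE (a : K) b := by
  refine (S.subtype.map_rel subR ![a, b]).symm.trans (iff_of_eq (congrArg _ ?_))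
  ext i; fin_cases i <;> rfl

theorem exleE_coe (a b : S) : exleE a b ↔ exleE (a : K) b := by
  refine (S.subtype.map_rel exleR ![a, b]).symm.trans (iff_of_eq (congrArg _ ?_))
  ext i; fin_cases i <;> rfl

end Substructure

namespace IsFinModel

section

variable {K : Type*} [Lmso.Structure K] [BooleanAlgebra K]

theorem exle_mono (h : IsFinModel K) {a b c d : K} (hac : a ≤ c) (hbd : b ≤ d)
    (hab : exleE a b) : exleE c d := by
  obtain ⟨x, y, hx, hy, hxa, hyb, hxy⟩ := (h.exle _ _).1 hab
  exact (h.exle _ _).2 ⟨x, y, hx, hy, hxa.trans hac, hyb.trans hbd, hxy⟩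

theorem subE_botE (h : IsFinModel K) (X : K) : subE (botE K) X := by
  rw [h.sub, h.bot]
  exact bot_le

end

theorem le_or_le_compl {K : Type*} [BooleanAlgebra K] {a : K} (ha : IsAtom a) (X : K) :
    a ≤ X ∨ a ≤ Xᶜ := by
  rcases ha.le_iff.1 (inf_le_left : a ⊓ X ≤ a) with h | h
  · exact Or.inr (le_compl_iff_disjoint_right.2 (disjoint_iff.2 h))
  · exact Or.inl (inf_eq_left.1 h)

theorem not_le_compl {K : Type*} [BooleanAlgebra K] {a : K} (ha : IsAtom a) {X : K}
    (h : a ≤ X) : ¬ a ≤ Xᶜ := fun h' =>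
  ha.1 (le_bot_iff.1 ((le_inf h h').trans (inf_compl_eq_bot (a := X)).le))

section

variable {K : Type*} [Lmso.Structure K] [BooleanAlgebra K]

/-- If `X` is downward closed, then the structure decomposes as the tensor product of its
parts below `X` and below the complement of `X`. -/
theorem nonempty_equiv_below (h : IsFinModel K) (X : K)
    (hX : ∀ a b, IsAtom a → IsAtom b → a ≤ X → exleE b a → b ≤ X) :
    Nonempty (K ≃[Lmso] below X (h.subE_botE X) × below Xᶜ (h.subE_botE Xᶜ)) := by
  let e : K ≃ below X (h.subE_botE X) × below Xᶜ (h.subE_botE Xᶜ) :=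
    { toFun := fun Z => (⟨Z ⊓ X, (h.sub _ _).2 inf_le_right⟩,
        ⟨Z ⊓ Xᶜ, (h.sub _ _).2 inf_le_right⟩)
      invFun := fun p => (p.1 : K) ⊔ p.2
      left_inv := fun Z => by
        change Z ⊓ X ⊔ Z ⊓ Xᶜ = Z
        rw [← inf_sup_left, sup_compl_eq_top, inf_top_eq]
      right_inv := by
        rintro ⟨⟨a, ha⟩, ⟨b, hb⟩⟩
        have ha' : a ≤ X := (h.sub _ _).1 ha
        have hb' : b ≤ Xᶜ := (h.sub _ _).1 hb
        refine Prod.ext (Subtype.ext ?_) (Subtype.ext ?_)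
        · change (a ⊔ b) ⊓ X = a
          rw [inf_sup_right, inf_eq_left.2 ha',
            (le_compl_iff_disjoint_right.1 hb').eq_bot, sup_bot_eq]
        · change (a ⊔ b) ⊓ Xᶜ = b
          rw [inf_sup_right, inf_eq_left.2 hb',
            (disjoint_compl_right.mono_left ha').eq_bot, bot_sup_eq] }
  have hbot : e (botE K) = botE _ := by
    refine Prod.ext (Subtype.ext ?_) (Subtype.ext ?_)
    · refine Eq.trans ?_ (coe_botE _).symm
      change botE K ⊓ X = botE K
      rw [h.bot, bot_inf_eq]
    · refine Eq.trans ?_ (coe_botE _).symm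
      change botE K ⊓ Xᶜ = botE K
      rw [h.bot, bot_inf_eq]
  have hsub (a b : K) : subE (e a) (e b) ↔ subE a b := by
    change subE (e a).1 (e b).1 ∧ subE (e a).2 (e b).2 ↔ _
    rw [subE_coe, subE_coe, h.sub, h.sub, h.sub]
    change a ⊓ X ≤ b ⊓ X ∧ a ⊓ Xᶜ ≤ b ⊓ Xᶜ ↔ a ≤ b
    refine ⟨fun hab => ?_, fun hab => ⟨inf_le_inf_right _ hab, inf_le_inf_right _ hab⟩⟩
    rw [← inf_top_eq a, ← sup_compl_eq_top (x := X), inf_sup_left]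
    exact sup_le (hab.1.trans inf_le_left) (hab.2.trans inf_le_left)
  refine ⟨equivOfPreserves e hbot (fun a => ?_) hsub fun a b => ?_⟩
  · change (e a ≠ botE _ ∧ ∀ q, subE q.1 (e a).1 → subE q.2 (e a).2 → q = botE _ ∨ q = e a) ↔ _
    rw [← hbot, h.atom, e.injective.ne_iff, h.bot]
    refine and_congr Iff.rfl ((e.forall_congr fun b => ?_).symm)
    rw [e.injective.eq_iff, e.injective.eq_iff, ← and_imp]
    change _ ↔ (subE (e b) (e a) → _)
    rw [hsub, h.sub, lt_iff_le_and_ne]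
    tauto
  · have hbot₁ : ((e a).1 ≠ botE _) ↔ a ⊓ X ≠ ⊥ := by
      rw [Ne, ← Subtype.coe_inj, coe_botE, h.bot]
      exact Iff.rfl
    have hbot₂ : ((e b).2 ≠ botE _) ↔ b ⊓ Xᶜ ≠ ⊥ := by
      rw [Ne, ← Subtype.coe_inj, coe_botE, h.bot]
      exact Iff.rfl
    change ((e a).1 ≠ botE _ ∧ (e b).2 ≠ botE _) ∨ exleE (e a).1 (e b).1 ∨
      exleE (e a).2 (e b).2 ↔ _
    rw [hbot₁, hbot₂, exleE_coe, exleE_coe]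
    change _ ∨ exleE (a ⊓ X) (b ⊓ X) ∨ exleE (a ⊓ Xᶜ) (b ⊓ Xᶜ) ↔ _
    constructor
    · rintro (⟨h₁, h₂⟩ | hab | hab)
      · obtain ⟨c, hc, hca⟩ := h.atomic _ h₁
        obtain ⟨d, hd, hdb⟩ := h.atomic _ h₂
        obtain ⟨hca, hcX⟩ := le_inf_iff.1 hca
        obtain ⟨hdb, hdX⟩ := le_inf_iff.1 hdb
        rcases h.trich c d hc hd with hcd | rfl | hcd
        · exact h.exle_mono hca hdb hcd
        · exact (not_le_compl hc hcX hdX).elim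
        · exact (not_le_compl hd (hX c d hc hd hcX hcd) hdX).elim
      · exact h.exle_mono inf_le_left inf_le_left hab
      · exact h.exle_mono inf_le_left inf_le_left hab
    · intro hab
      obtain ⟨c, d, hc, hd, hca, hdb, hcd⟩ := (h.exle _ _).1 hab
      rcases le_or_le_compl hc X with hcX | hcX <;> rcases le_or_le_compl hd X with hdX | hdX
      · exact Or.inr (Or.inl (h.exle_mono (le_inf hca hcX) (le_inf hdb hdX) hcd))
      · exact Or.inl ⟨fun e => hc.1 (le_bot_iff.1 (e ▸ le_inf hca hcX)),
          fun e => hd.1 (le_bot_iff.1 (e ▸ le_inf hdb hdX))⟩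
      · exact (not_le_compl hc (hX d c hd hc hdX hcd) hcX).elim
      · exact Or.inr (Or.inr (h.exle_mono (le_inf hca hcX) (le_inf hdb hdX) hcd))

theorem exists_below_of_realize_plusSent (h : IsFinModel K) {φ ψ : Lmso.Sentence}
    (hK : K ⊨ plusSent φ ψ) : ∃ X : K,
      (∀ a b, IsAtom a → IsAtom b → a ≤ X → exleE b a → b ≤ X) ∧
      below X (h.subE_botE X) ⊨ φ ∧ below Xᶜ (h.subE_botE Xᶜ) ⊨ ψ := by
  obtain ⟨X, Y, hX, ⟨hXY, hXY'⟩, hφ, hψ⟩ := (realize_plusSent φ ψ).1 hK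
  simp only [h.atom, h.sub, h.bot] at hX hXY hXY'
  have hY : Y = Xᶜ := (IsCompl.compl_eq ⟨disjoint_iff.2 (hXY _ inf_le_left inf_le_right),
    codisjoint_iff.2 (top_le_iff.1 (hXY' _ le_sup_left le_sup_right _))⟩).symm
  subst hY
  exact ⟨X, hX, (realize_relv_below φ _ 0 (h.subE_botE X)).1 hφ,
    (realize_relv_below ψ _ 1 (h.subE_botE Xᶜ)).1 hψ⟩

end

variable {M N : Type} [Lmso.Structure M] [Lmso.Structure N] [BooleanAlgebra M] [BooleanAlgebra N]

theorem nonempty_equiv_below_left (hM : IsFinModel M) (hN : IsFinModel N)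
    (hX : subE (botE (M × N)) (⊤, ⊥)) :
    Nonempty (M ≃[Lmso] below ((⊤, ⊥) : M × N) hX) := by
  have h := isFinModel_prod hM hN
  let e : M ≃ below ((⊤, ⊥) : M × N) hX :=
    { toFun := fun a => ⟨(a, ⊥), (h.sub _ _).2 ⟨le_top, le_rfl⟩⟩
      invFun := fun p => p.1.1
      left_inv := fun _ => rfl
      right_inv := fun p => Subtype.ext (Prod.ext rfl
        (le_bot_iff.1 ((h.sub _ _).1 p.2).2).symm) }
  refine ⟨equivOfPreserves e (Subtype.ext ?_) (fun a => ?_) (fun a b => ?_) fun a b => ?_⟩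
  · rw [coe_botE, h.bot, hM.bot]
    rfl
  · rw [atE_coe, h.atom, hM.atom, isAtom_prod_iff]
    exact ⟨fun h => h.elim And.left fun h => (h.2.1 rfl).elim, fun h => Or.inl ⟨h, rfl⟩⟩
  · rw [subE_coe, h.sub, hM.sub]
    exact and_iff_left le_rfl
  · rw [exleE_coe, exleE_prod hM hN]
    exact ⟨fun h => h.elim (fun h => (h.2 rfl).elim)
      (Or.resolve_right · (hN.not_exle_bot_left ⊥)), fun h => Or.inr (Or.inl h)⟩

theorem nonempty_equiv_below_right (hM : IsFinModel M) (hN : IsFinModel N)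
    (hX : subE (botE (M × N)) (⊥, ⊤)) :
    Nonempty (N ≃[Lmso] below ((⊥, ⊤) : M × N) hX) := by
  have h := isFinModel_prod hM hN
  let e : N ≃ below ((⊥, ⊤) : M × N) hX :=
    { toFun := fun b => ⟨(⊥, b), (h.sub _ _).2 ⟨le_rfl, le_top⟩⟩
      invFun := fun p => p.1.2
      left_inv := fun _ => rfl
      right_inv := fun p => Subtype.ext (Prod.ext
        (le_bot_iff.1 ((h.sub _ _).1 p.2).1).symm rfl) }
  refine ⟨equivOfPreserves e (Subtype.ext ?_) (fun a => ?_) (fun a b => ?_) fun a b => ?_⟩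
  · rw [coe_botE, h.bot, hN.bot]
    rfl
  · rw [atE_coe, h.atom, hN.atom, isAtom_prod_iff]
    exact ⟨fun h => h.elim (fun h => (h.1.1 rfl).elim) And.right, fun h => Or.inr ⟨rfl, h⟩⟩
  · rw [subE_coe, h.sub, hN.sub]
    exact and_iff_right le_rfl
  · rw [exleE_coe, exleE_prod hM hN]
    exact ⟨fun h => h.elim (fun h => (h.1 rfl).elim)
      (Or.resolve_left · (hM.not_exle_bot_left ⊥)), fun h => Or.inr (Or.inr h)⟩

theorem realize_plusSent_prod (hM : IsFinModel M) (hN : IsFinModel N) {φ ψ : Lmso.Sentence}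
    (hφ : M ⊨ φ) (hψ : N ⊨ ψ) : (M × N) ⊨ plusSent φ ψ := by
  have h := isFinModel_prod hM hN
  obtain ⟨e₁⟩ := nonempty_equiv_below_left hM hN (h.subE_botE _)
  obtain ⟨e₂⟩ := nonempty_equiv_below_right hM hN (h.subE_botE _)
  refine (realize_plusSent φ ψ).2 ⟨(⊤, ⊥), (⊥, ⊤), ?_, ⟨?_, ?_⟩,
    (realize_relv_below φ _ 0 (h.subE_botE _)).2 ((StrongHomClass.realize_sentence e₁ φ).1 hφ),
    (realize_relv_below ψ _ 1 (h.subE_botE _)).2 ((StrongHomClass.realize_sentence e₂ ψ).1 hψ)⟩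
  · simp only [h.atom, h.sub]
    rintro p q hp hq hpX hqp
    have hp₂ : p.2 = ⊥ := le_bot_iff.1 hpX.2
    refine ⟨le_top, le_bot_iff.2 ?_⟩
    rw [isAtom_prod_iff] at hq
    rcases hq with hq | hq
    · exact hq.2
    · rw [exleE_prod hM hN, hq.1, hp₂] at hqp
      rcases hqp with hqp | hqp | hqp
      · exact (hqp.1 rfl).elim
      · exact (hM.not_exle_bot_left _ hqp).elim
      · exact (hN.not_exle_bot_right _ hqp).elim
  · simp only [h.sub, h.bot]
    exact fun z h₁ h₂ => Prod.ext (le_bot_iff.1 h₂.1) (le_bot_iff.1 h₁.2)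
  · simp only [h.sub]
    exact fun z h₁ h₂ w => ⟨le_top.trans h₁.1, le_top.trans h₂.2⟩

end IsFinModel

end Sum

theorem statement19 (x y : Lmso.Theory) (hx : x.IsComplete) (hy : y.IsComplete)
    (hxe : TMSOFin ⊆ x) (hye : TMSOFin ⊆ y)
    (M N : Type) [Lmso.Structure M] [Lmso.Structure N] (hM : M ⊨ x) (hN : N ⊨ y) :
    ((Lmso.completeTheory (M × N)).IsComplete ∧ TMSOFin ⊆ Lmso.completeTheory (M × N)) ∧
    (∀ φ ψ : Lmso.Sentence, x ⊨ᵇ φ → y ⊨ᵇ ψ → (M × N) ⊨ plusSent φ ψ) ∧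
    (∀ T : Lmso.Theory, T.IsComplete → TMSOFin ⊆ T →
      (∀ φ ψ : Lmso.Sentence, x ⊨ᵇ φ → y ⊨ᵇ ψ → T ⊨ᵇ plusSent φ ψ) →
      ∀ χ : Lmso.Sentence, T ⊨ᵇ χ ↔ (M × N) ⊨ χ) ∧
    (∀ χ : Lmso.Sentence, (M × N) ⊨ χ →
      ∃ l : List (Lmso.Sentence × Lmso.Sentence),
        (∀ p ∈ l, x ⊨ᵇ p.1 ∧ y ⊨ᵇ p.2) ∧
        TMSOFin ⊨ᵇ (bigAnd (l.map fun p => plusSent p.1 p.2) ⟹ χ)) := by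
  have : M ⊨ TMSOFin := hM.mono hxe
  have : N ⊨ TMSOFin := hN.mono hye
  obtain ⟨_, hM'⟩ := exists_isFinModel (K := M) inferInstance
  obtain ⟨_, hN'⟩ := exists_isFinModel (K := N) inferInstance
  have : Nonempty M := ⟨⊥⟩
  have : Nonempty N := ⟨⊥⟩
  have generates : ∀ χ : Lmso.Sentence, (M × N) ⊨ χ →
      ∃ l : List (Lmso.Sentence × Lmso.Sentence),
        (∀ p ∈ l, x ⊨ᵇ p.1 ∧ y ⊨ᵇ p.2) ∧
        TMSOFin ⊨ᵇ (bigAnd (l.map fun p => plusSent p.1 p.2) ⟹ χ) := by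
    intro χ hχ
    obtain ⟨l, hl⟩ := fefermanVaught_sentence χ
    obtain ⟨p, hp, h₁, h₂⟩ := (hl M N).1 hχ
    refine ⟨[p], fun q hq => ?_, ?_⟩
    · obtain rfl := List.mem_singleton.1 hq
      exact ⟨(hx.realize_sentence_iff q.1 M).1 h₁, (hy.realize_sentence_iff q.2 N).1 h₂⟩
    · refine Theory.models_sentence_iff.2 fun K => ?_
      obtain ⟨_, hK⟩ := exists_isFinModel (K := K) inferInstance
      refine BoundedFormula.realize_imp.2 fun hplus => ?_
      have hplus : K ⊨ plusSent p.1 p.2 := (BoundedFormula.realize_inf.1 hplus).1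
      obtain ⟨X, hX, hφ, hψ⟩ := hK.exists_below_of_realize_plusSent hplus
      obtain ⟨e⟩ := hK.nonempty_equiv_below X hX
      exact (StrongHomClass.realize_sentence e χ).2 ((hl _ _).2 ⟨p, hp, hφ, hψ⟩)
  have models : ∀ T : Lmso.Theory, TMSOFin ⊆ T →
      (∀ φ ψ : Lmso.Sentence, x ⊨ᵇ φ → y ⊨ᵇ ψ → T ⊨ᵇ plusSent φ ψ) →
      ∀ χ : Lmso.Sentence, (M × N) ⊨ χ → T ⊨ᵇ χ := by
    intro T hT hplus χ hχ
    obtain ⟨l, hl, hlχ⟩ := generates χ hχ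
    refine Theory.models_sentence_iff.2 fun K => ?_
    have : K ⊨ TMSOFin := Theory.Model.mono (T' := T) inferInstance hT
    refine BoundedFormula.realize_imp.1 (hlχ.realize_sentence K) ?_
    clear hlχ
    induction l with
    | nil => exact BoundedFormula.realize_top.2 trivial
    | cons p l ih =>
      rw [List.forall_mem_cons] at hl
      exact BoundedFormula.realize_inf.2
        ⟨(hplus _ _ hl.1.1 hl.1.2).realize_sentence K, ih hl.2⟩
  refine ⟨⟨completeTheory.isComplete Lmso (M × N), fun φ hφ => ?_⟩, fun φ ψ hφ hψ => ?_,
    fun T hT hTe hplus χ => ⟨fun hχ => ?_, models T hTe hplus χ⟩, generates⟩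
  · exact (isFinModel_prod hM' hN').model.realize_of_mem φ hφ
  · exact hM'.realize_plusSent_prod hN' (hφ.realize_sentence M) (hψ.realize_sentence N)
  · by_contra h
    have hnot := models T hTe hplus χ.not ((Sentence.realize_not _).2 h)
    obtain ⟨K⟩ := hT.1
    exact (Sentence.realize_not K).1 (hnot.realize_sentence K) (hχ.realize_sentence K)

end MSO
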